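/- Let Δ ≥ 7 be an integer and let G be a minimal counterexample to the bound χ'_s ≤ 3Δ for graphs with Mad ≤ 3, maximum degree at most Δ, and no 3-regular subgraph. Then for every vertex v of G*: (i) if d_{G*}(v) < Δ, then at least one neighbor of v in G* is neither poor nor very poor (i.e., is neither a vertex of degree 2 in G* nor a poor 3-vertex); (ii) if d_{G*}(v) = Δ, then either at least one neighbor of v in G* is neither poor nor very poor, or v is not a sponsor of any very poor vertex. -/

import Mathlib

open scoped Classical

namespace StrongEC

/-- Two edges of `G` conflict for strong edge-coloring: they are distinct and either share
an endpoint or are both adjacent to a common edge of `G`. -/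
def Conflict {V : Type*} (G : SimpleGraph V) (e e' : Sym2 V) : Prop :=
  e ≠ e' ∧ ((∃ v, v ∈ e ∧ v ∈ e') ∨
    ∃ f ∈ G.edgeSet, (∃ v, v ∈ e ∧ v ∈ f) ∧ (∃ w, w ∈ e' ∧ w ∈ f))

/-- `C` is a strong edge-coloring of `G` with `k` colors. -/
def IsStrongColoring {V : Type*} (G : SimpleGraph V) {k : ℕ} (C : Sym2 V → Fin k) : Prop :=
  ∀ e ∈ G.edgeSet, ∀ e' ∈ G.edgeSet, Conflict G e e' → C e ≠ C e'

/-- `G` admits a strong `k`-edge-coloring. -/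
def HasStrongColoring {V : Type*} (G : SimpleGraph V) (k : ℕ) : Prop :=
  ∃ C : Sym2 V → Fin k, IsStrongColoring G C

/-- The strong chromatic index of `G`: the least `k` such that `G` admits a strong
`k`-edge-coloring. -/
noncomputable def strongChromaticIndex {V : Type*} (G : SimpleGraph V) : ℕ :=
  sInf {k | HasStrongColoring G k}

/-- The maximum average degree of a finite graph `G`: the supremum over nonempty vertex
subsets `A` of `2 * e(A) / |A|`, where `e(A)` is the number of edges of `G` inside `A`
(this equals the maximum of `2|E(H)|/|V(H)|` over all subgraphs `H` with at least one
vertex). -/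
noncomputable def mad {V : Type*} (G : SimpleGraph V) : ℝ :=
  sSup {x : ℝ | ∃ A : Finset V, A.Nonempty ∧
    x = 2 * ({e ∈ G.edgeSet | ∀ v ∈ e, v ∈ A}.ncard : ℝ) / (A.card : ℝ)}

/-- `G` has a 3-regular subgraph: a subgraph on a nonempty vertex set all of whose
vertices have degree exactly 3 in it. -/
def Has3RegularSubgraph {V : Type*} (G : SimpleGraph V) : Prop :=
  ∃ H : SimpleGraph V, H ≤ G ∧ H.support.Nonempty ∧
    ∀ v ∈ H.support, (H.neighborSet v).ncard = 3

/-- The graph `G*` obtained from `G` by deleting all vertices of degree 1 in `G`. -/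
noncomputable def core {V : Type*} [Fintype V] (G : SimpleGraph V) : SimpleGraph V :=
  SimpleGraph.fromRel (fun u v => G.Adj u v ∧ G.degree u ≠ 1 ∧ G.degree v ≠ 1)

/-- The number of vertices of degree at least 2. -/
noncomputable def twoPlusCount {W : Type} [Fintype W] (H : SimpleGraph W) : ℕ :=
  (Finset.univ.filter (fun v : W => 2 ≤ H.degree v)).card

/-- A graph with maximum average degree at most `3`, maximum degree at most `Δ`, and no
3-regular subgraph. -/
def GoodB (Δ : ℕ) {W : Type} [Fintype W] (H : SimpleGraph W) : Prop :=
  mad H ≤ 3 ∧ H.maxDegree ≤ Δ ∧ ¬ Has3RegularSubgraph H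

/-- `G` is a minimal counterexample to the bound `χ'_s ≤ 3Δ` for graphs with `Mad ≤ 3`,
maximum degree at most `Δ` and no 3-regular subgraph. -/
def MinCexB (Δ : ℕ) {V : Type} [Fintype V] (G : SimpleGraph V) : Prop :=
  GoodB Δ G ∧ ¬ HasStrongColoring G (3 * Δ) ∧
    ∀ (W : Type) [Fintype W] (H : SimpleGraph W), GoodB Δ H →
      (twoPlusCount H < twoPlusCount G ∨
        (twoPlusCount H = twoPlusCount G ∧ H.edgeSet.ncard < G.edgeSet.ncard)) →
      HasStrongColoring H (3 * Δ)

/-- A poor 3-vertex: a vertex of degree 3 in `G*` exactly one of whose neighbors in `G*`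
has degree 2 in `G*`. -/
def Poor3 {V : Type} [Fintype V] (G : SimpleGraph V) (v : V) : Prop :=
  (core G).degree v = 3 ∧
    (((core G).neighborFinset v).filter (fun u => (core G).degree u = 2)).card = 1

/-- `u` is a very poor vertex with sponsor `v` and rival `w`: `u` has degree 2 in `G*`
with neighbors `v` and `w` in `G*`, and one of (T1), (T2), (T3) holds for `w`. -/
def VeryPoorWith {V : Type} [Fintype V] (G : SimpleGraph V) (u v w : V) : Prop :=
  (core G).degree u = 2 ∧ (core G).Adj u v ∧ (core G).Adj u w ∧ v ≠ w ∧
    ((core G).degree w = 2 ∨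
      ((core G).degree w = 3 ∧
        2 ≤ (((core G).neighborFinset w).filter (fun x => (core G).degree x = 2)).card) ∨
      ((core G).degree w = 4 ∧
        (((core G).neighborFinset w).filter
          (fun x => ¬ ((core G).degree x = 2 ∨ Poor3 G x))).card ≤ 1))

section part1
variable {V : Type} [Fintype V]

def ValidOn (G : SimpleGraph V) {n : ℕ} (M : Finset (Sym2 V)) (C : Sym2 V → Fin n) : Prop :=
  ∀ e ∈ M, ∀ e' ∈ M, Conflict G e e' → C e ≠ C e'

lemma Conflict.symm {G : SimpleGraph V} {e e' : Sym2 V} (h : Conflict G e e') :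
    Conflict G e' e := by
  obtain ⟨h1, h2⟩ := h
  refine ⟨h1.symm, ?_⟩
  rcases h2 with ⟨v, a, b⟩ | ⟨f, hf, a, b⟩
  · exact Or.inl ⟨v, b, a⟩
  · exact Or.inr ⟨f, hf, b, a⟩

lemma exists_K (G : SimpleGraph V) (n : ℕ) (h : ¬ HasStrongColoring G n) :
    ∃ K : Finset (Sym2 V), K ⊆ G.edgeFinset ∧ (¬ ∃ C : Sym2 V → Fin n, ValidOn G K C) ∧
      ∀ e ∈ K, n ≤ (K.filter (fun e' => Conflict G e e')).card := by
  have h0 : ¬ ∃ C : Sym2 V → Fin n, ValidOn G G.edgeFinset C := by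
    rintro ⟨C, hC⟩
    exact h ⟨C, fun e he e' he' => hC e (by simpa using he) e' (by simpa using he')⟩
  obtain ⟨K, hKm⟩ := Finset.exists_minimal (s := G.edgeFinset.powerset.filter
    (fun M => ¬ ∃ C : Sym2 V → Fin n, ValidOn G M C)) ⟨G.edgeFinset, by simpa using h0⟩
  have hK := hKm.prop
  rw [Finset.mem_filter, Finset.mem_powerset] at hK
  refine ⟨K, hK.1, hK.2, ?_⟩
  intro e he
  by_contra hlt
  push Not at hlt
  have hcol : ∃ C : Sym2 V → Fin n, ValidOn G (K.erase e) C := by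
    by_contra hno
    have hm : K.erase e ∈ G.edgeFinset.powerset.filter
        (fun M => ¬ ∃ C : Sym2 V → Fin n, ValidOn G M C) := by
      rw [Finset.mem_filter, Finset.mem_powerset]
      exact ⟨(Finset.erase_subset _ _).trans hK.1, hno⟩
    have := hKm.le_of_le hm (Finset.erase_subset _ _)
    exact Finset.notMem_erase e K (this he)
  obtain ⟨C, hC⟩ := hcol
  have hc : (((K.filter (fun e' => Conflict G e e')).image C)).card <
      (Finset.univ : Finset (Fin n)).card := by
    rw [Finset.card_univ, Fintype.card_fin]
    exact lt_of_le_of_lt Finset.card_image_le hlt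
  obtain ⟨c, -, hcn⟩ := Finset.exists_mem_notMem_of_card_lt_card hc
  apply hK.2
  refine ⟨Function.update C e c, ?_⟩
  have key : ∀ e' ∈ K, Conflict G e e' → c ≠ C e' := by
    intro e' he' hcf hh
    exact hcn (Finset.mem_image.2 ⟨e', Finset.mem_filter.2 ⟨he', hcf⟩, hh.symm⟩)
  intro a ha b hb hab
  by_cases hae : a = e
  · subst hae
    have hba : b ≠ a := hab.1.symm
    rw [Function.update_self, Function.update_of_ne hba]
    exact key b hb hab
  · by_cases hbe : b = e
    · subst hbe
      rw [Function.update_self, Function.update_of_ne hae]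
      exact (key a ha hab.symm).symm
    · rw [Function.update_of_ne hae, Function.update_of_ne hbe]
      exact hC a (Finset.mem_erase.2 ⟨hae, ha⟩) b (Finset.mem_erase.2 ⟨hbe, hb⟩) hab

/-- number of edges of `K` at a vertex -/
noncomputable def dK (K : Finset (Sym2 V)) (x : V) : ℕ := (K.filter (fun e => x ∈ e)).card

lemma dK_le (G : SimpleGraph V) (K : Finset (Sym2 V)) (hK : K ⊆ G.edgeFinset) (x : V) :
    dK K x ≤ G.degree x := by
  rw [← SimpleGraph.card_incidenceFinset_eq_degree]
  apply Finset.card_le_card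
  intro e he
  rw [Finset.mem_filter] at he
  rw [SimpleGraph.mem_incidenceFinset]
  exact ⟨by simpa using hK he.1, he.2⟩

/-- The conflict neighbourhood of an edge `uv` -/
lemma conflict_incident {G : SimpleGraph V} {u v : V} {e' : Sym2 V} (he' : e' ∈ G.edgeSet)
    (h : Conflict G s(u, v) e') :
    ∃ x ∈ (G.neighborFinset u).erase v ∪ (G.neighborFinset v).erase u, x ∈ e' := by
  obtain ⟨hne, h⟩ := h
  have hu : ∀ u v : V, s(u, v) ≠ e' → u ∈ e' → ∃ x, G.Adj u x ∧ x ≠ v ∧ x ∈ e' := by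
    intro u v hne hu
    obtain ⟨x, rfl⟩ := hu
    refine ⟨x, he', ?_, by simp⟩
    rintro rfl
    exact hne rfl
  have hu1 : u ∈ e' → ∃ x ∈ (G.neighborFinset u).erase v ∪ (G.neighborFinset v).erase u, x ∈ e' := by
    intro h1
    obtain ⟨x, h2, h3, h4⟩ := hu u v hne h1
    exact ⟨x, by simp [h2, h3], h4⟩
  have hv1 : v ∈ e' → ∃ x ∈ (G.neighborFinset u).erase v ∪ (G.neighborFinset v).erase u, x ∈ e' := by
    intro h1
    obtain ⟨x, h2, h3, h4⟩ := hu v u (by rwa [Sym2.eq_swap]) h1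
    exact ⟨x, by simp [h2, h3], h4⟩
  rcases h with ⟨w, hw, hw'⟩ | ⟨f, hf, ⟨w, hw, hwf⟩, ⟨z, hz, hzf⟩⟩
  · rcases Sym2.mem_iff.1 hw with rfl | rfl
    · exact hu1 hw'
    · exact hv1 hw'
  · obtain ⟨q, rfl⟩ := hwf
    rw [SimpleGraph.mem_edgeSet] at hf
    rcases Sym2.mem_iff.1 hw with rfl | rfl
    · rcases Sym2.mem_iff.1 hzf with rfl | rfl
      · exact hu1 hz
      · by_cases hq : z = v
        · subst hq; exact hv1 hz
        · exact ⟨z, by simp [hf, hq], hz⟩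
    · rcases Sym2.mem_iff.1 hzf with rfl | rfl
      · exact hv1 hz
      · by_cases hq : z = u
        · subst hq; exact hu1 hz
        · exact ⟨z, by simp [hf, hq], hz⟩

lemma count_union {G : SimpleGraph V} {n : ℕ} {K : Finset (Sym2 V)} (hK : K ⊆ G.edgeFinset)
    (hc : ∀ e ∈ K, n ≤ (K.filter (fun e' => Conflict G e e')).card) {u v : V}
    (huv : s(u, v) ∈ K) :
    n ≤ ∑ x ∈ (G.neighborFinset u).erase v ∪ (G.neighborFinset v).erase u, dK K x := by
  refine (hc _ huv).trans ?_
  refine le_trans (Finset.card_le_card (t := ((G.neighborFinset u).erase v ∪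
    (G.neighborFinset v).erase u).biUnion (fun x => K.filter (fun e => x ∈ e))) ?_)
    Finset.card_biUnion_le
  intro e' he'
  rw [Finset.mem_filter] at he'
  obtain ⟨x, hx, hxe⟩ := conflict_incident (by simpa using hK he'.1) he'.2
  exact Finset.mem_biUnion.2 ⟨x, hx, Finset.mem_filter.2 ⟨he'.1, hxe⟩⟩

lemma count_sum {G : SimpleGraph V} {n : ℕ} {K : Finset (Sym2 V)} (hK : K ⊆ G.edgeFinset)
    (hc : ∀ e ∈ K, n ≤ (K.filter (fun e' => Conflict G e e')).card) {u v : V}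
    (huv : s(u, v) ∈ K) :
    n ≤ ∑ x ∈ (G.neighborFinset u).erase v, dK K x
      + ∑ x ∈ (G.neighborFinset v).erase u, dK K x := by
  refine (count_union hK hc huv).trans ?_
  rw [← Finset.sum_union_inter]
  exact Nat.le_add_right _ _

/-- the combinatorial class, closed under the reductions -/
structure Cls (Δ : ℕ) (G : SimpleGraph V) : Prop where
  sp : ∀ A : Finset V, ∑ v ∈ A, (G.neighborFinset v ∩ A).card ≤ 3 * A.card
  dg : ∀ v, G.degree v ≤ Δ
  rg : ¬ Has3RegularSubgraph G

lemma Cls.mono {Δ : ℕ} {G H : SimpleGraph V} (h : Cls Δ G) (hle : H ≤ G) : Cls Δ H where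
  sp A := by
    refine le_trans (Finset.sum_le_sum fun v _ => Finset.card_le_card ?_) (h.sp A)
    intro x hx
    simp only [Finset.mem_inter, SimpleGraph.mem_neighborFinset] at hx ⊢
    exact ⟨hle hx.1, hx.2⟩
  dg v := (SimpleGraph.degree_le_of_le hle).trans (h.dg v)
  rg := by
    rintro ⟨F, hF, h1, h2⟩
    exact h.rg ⟨F, hF.trans hle, h1, h2⟩

/-- minimal counterexample with respect to the number of edges -/
structure MinC (Δ : ℕ) (G : SimpleGraph V) : Prop where
  cls : Cls Δ G
  nc : ¬ HasStrongColoring G (3 * Δ)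
  mn : ∀ H : SimpleGraph V, Cls Δ H → H.edgeSet.ncard < G.edgeSet.ncard →
    HasStrongColoring H (3 * Δ)

lemma covered {Δ : ℕ} {G : SimpleGraph V} (hG : MinC Δ G) {K : Finset (Sym2 V)}
    (hK : K ⊆ G.edgeFinset) (hn : ¬ ∃ C : Sym2 V → Fin (3 * Δ), ValidOn G K C)
    {x y : V} (hxy : G.Adj x y) : ∃ e ∈ K, x ∈ e := by
  by_contra hno
  push Not at hno
  have hle : G.deleteEdges {s(x, y)} ≤ G := SimpleGraph.deleteEdges_le _
  have hlt : G.deleteEdges {s(x, y)} < G := by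
    refine lt_of_le_of_ne hle ?_
    intro h
    have : (G.deleteEdges {s(x, y)}).Adj x y := by rw [h]; exact hxy
    simp at this
  obtain ⟨C, hC⟩ := hG.mn _ (hG.cls.mono hle)
    (Set.ncard_lt_ncard (SimpleGraph.edgeSet_strict_mono hlt) (Set.toFinite _))
  apply hn
  refine ⟨C, ?_⟩
  have hmem : ∀ e ∈ G.edgeSet, e ≠ s(x, y) → e ∈ (G.deleteEdges {s(x, y)}).edgeSet := by
    intro e he hne
    rw [SimpleGraph.edgeSet_deleteEdges]
    exact ⟨he, hne⟩
  have hKm : ∀ e ∈ K, e ∈ (G.deleteEdges {s(x, y)}).edgeSet := by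
    intro e he
    refine hmem e (by simpa using hK he) ?_
    rintro rfl
    exact hno _ he (by simp)
  intro e he e' he' hcf
  refine hC e (hKm e he) e' (hKm e' he') ⟨hcf.1, ?_⟩
  rcases hcf.2 with h | ⟨f, hf, ⟨p, hp, hpf⟩, ⟨q, hq, hqf⟩⟩
  · exact Or.inl h
  · by_cases hfe : f = s(x, y)
    · subst hfe
      rcases Sym2.mem_iff.1 hpf with rfl | rfl
      · exact absurd hp (hno _ he)
      · rcases Sym2.mem_iff.1 hqf with rfl | rfl
        · exact absurd hq (hno _ he')
        · exact Or.inl ⟨_, hp, hq⟩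
    · exact Or.inr ⟨f, hmem f hf hfe, ⟨p, hp, hpf⟩, ⟨q, hq, hqf⟩⟩

end part1

section part2
variable {V : Type} [Fintype V]

/-- context: the critical edge set `K` and its counting properties -/
structure Ctx (Δ : ℕ) (G : SimpleGraph V) (K : Finset (Sym2 V)) : Prop where
  hΔ : 7 ≤ Δ
  cls : Cls Δ G
  hK : K ⊆ G.edgeFinset
  cu : ∀ u v, s(u, v) ∈ K →
    3 * Δ ≤ ∑ x ∈ (G.neighborFinset u).erase v ∪ (G.neighborFinset v).erase u, dK K x
  cov : ∀ x y, G.Adj x y → 1 ≤ dK K x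

lemma dK_eq {G : SimpleGraph V} {K : Finset (Sym2 V)} (hK : K ⊆ G.edgeFinset) (x : V) :
    dK K x = ((G.neighborFinset x).filter (fun t => s(x, t) ∈ K)).card := by
  unfold dK
  symm
  apply Finset.card_bij (fun t _ => s(x, t))
  · intro t ht
    simp only [Finset.mem_filter] at ht ⊢
    exact ⟨ht.2, by simp⟩
  · intro a _ b _ h
    exact Sym2.congr_right.1 h
  · intro e he
    rw [Finset.mem_filter] at he
    obtain ⟨h1, t, rfl⟩ := he
    refine ⟨t, ?_, rfl⟩
    have := hK h1
    simp only [SimpleGraph.mem_edgeFinset, SimpleGraph.mem_edgeSet] at this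
    simp [this, h1]

variable {Δ : ℕ} {G : SimpleGraph V} {K : Finset (Sym2 V)}

lemma Ctx.cs (h : Ctx Δ G K) {u v : V} (huv : s(u, v) ∈ K) :
    3 * Δ ≤ ∑ x ∈ (G.neighborFinset u).erase v, dK K x
      + ∑ x ∈ (G.neighborFinset v).erase u, dK K x := by
  refine (h.cu _ _ huv).trans ?_
  rw [← Finset.sum_union_inter]
  exact Nat.le_add_right _ _

lemma Ctx.dle (h : Ctx Δ G K) (x : V) : dK K x ≤ G.degree x := dK_le G K h.hK x

lemma Ctx.dΔ (h : Ctx Δ G K) (x : V) : dK K x ≤ Δ := (h.dle x).trans (h.cls.dg x)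

lemma two_nbrs {y v w : V} (hd : G.degree y = 2) (h1 : G.Adj y v) (h2 : G.Adj y w)
    (h : v ≠ w) : G.neighborFinset y = {v, w} := by
  symm
  apply Finset.eq_of_subset_of_card_le
  · intro x hx
    simp only [Finset.mem_insert, Finset.mem_singleton] at hx
    rcases hx with rfl | rfl <;> simpa
  · rw [SimpleGraph.card_neighborFinset_eq_degree, hd, Finset.card_pair h]

lemma other_nbr {y v : V} (hd : G.degree y = 2) (h1 : G.Adj y v) :
    ∃ w, w ≠ v ∧ G.Adj y w ∧ G.neighborFinset y = {v, w} := by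
  have : 1 < (G.neighborFinset y).card := by
    rw [SimpleGraph.card_neighborFinset_eq_degree, hd]; norm_num
  obtain ⟨w, hw, hne⟩ := Finset.exists_mem_ne this v
  rw [SimpleGraph.mem_neighborFinset] at hw
  exact ⟨w, hne, hw, two_nbrs hd h1 hw hne.symm⟩

lemma Ctx.f1 (h : Ctx Δ G K) {a b : V} (ha : G.degree a = 2) (hb : G.degree b = 2)
    (hab : G.Adj a b) : s(a, b) ∉ K := by
  intro hk
  have := h.cs hk
  obtain ⟨v, hv, -, hN⟩ := other_nbr ha hab
  obtain ⟨r, hr, -, hM⟩ := other_nbr hb hab.symm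
  rw [hN, hM] at this
  rw [Finset.erase_insert (by simpa using hv.symm), Finset.erase_insert (by simpa using hr.symm)]
    at this
  simp only [Finset.sum_singleton] at this
  have h1 := h.dΔ v
  have h2 := h.dΔ r
  have := h.hΔ
  omega

/-- every edge of `K` at `y` is one of the two edges -/
lemma Ctx.edge_at {y v w : V} (h : Ctx Δ G K) (hN : G.neighborFinset y = {v, w})
    (hw : s(y, w) ∉ K) {e : Sym2 V} (he : e ∈ K) (hy : y ∈ e) : e = s(y, v) := by
  obtain ⟨t, rfl⟩ := hy
  have h1 : t ∈ G.neighborFinset y := by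
    simpa using h.hK he
  rw [hN] at h1
  simp only [Finset.mem_insert, Finset.mem_singleton] at h1
  rcases h1 with rfl | rfl
  · rfl
  · exact absurd he hw

lemma Ctx.one_edge {y v w : V} (h : Ctx Δ G K) (hN : G.neighborFinset y = {v, w})
    (hw : s(y, w) ∉ K) : s(y, v) ∈ K ∧ dK K y = 1 := by
  have hv : G.Adj y v := by
    rw [← SimpleGraph.mem_neighborFinset, hN]; simp
  have hc := h.cov y v hv
  have hle : dK K y ≤ 1 := by
    unfold dK
    rw [Finset.card_le_one]
    intro a ha b hb
    rw [Finset.mem_filter] at ha hb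
    rw [h.edge_at hN hw ha.1 ha.2, h.edge_at hN hw hb.1 hb.2]
  refine ⟨?_, by omega⟩
  unfold dK at hc
  obtain ⟨e, he⟩ := Finset.card_pos.1 hc
  rw [Finset.mem_filter] at he
  rw [← h.edge_at hN hw he.1 he.2]
  exact he.1

/-- the reduced graph -/
def redG (G : SimpleGraph V) (y1 w1 y2 w2 : V) (hw : w1 ≠ w2) : SimpleGraph V where
  Adj a b := (G.Adj a b ∧ s(a, b) ≠ s(y1, w1) ∧ s(a, b) ≠ s(y2, w2)) ∨ s(a, b) = s(w1, w2)
  symm := ⟨by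
    intro a b h
    rw [Sym2.eq_swap (a := b) (b := a)]
    rcases h with ⟨h1, h2, h3⟩ | h
    · exact Or.inl ⟨h1.symm, h2, h3⟩
    · exact Or.inr h⟩
  loopless := ⟨by
    intro a h
    rcases h with ⟨h1, h2, h3⟩ | h
    · exact G.loopless.irrefl a h1
    · rw [Sym2.eq_iff] at h
      rcases h with ⟨rfl, rfl⟩ | ⟨rfl, rfl⟩ <;> exact hw rfl⟩

lemma redG_ncard {y1 w1 y2 w2 : V} (hw : w1 ≠ w2) (h1 : G.Adj y1 w1) (h2 : G.Adj y2 w2)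
    (hne : s(y1, w1) ≠ s(y2, w2)) :
    (redG G y1 w1 y2 w2 hw).edgeSet.ncard < G.edgeSet.ncard := by
  have hsub : (redG G y1 w1 y2 w2 hw).edgeSet ⊆
      insert s(w1, w2) (G.edgeSet \ {s(y1, w1), s(y2, w2)}) := by
    intro e
    induction e using Sym2.ind with
    | _ a b =>
      intro he
      rcases he with ⟨h1, h2, h3⟩ | h
      · right
        refine ⟨h1, ?_⟩
        simp only [Set.mem_insert_iff, Set.mem_singleton_iff, not_or]
        exact ⟨h2, h3⟩
      · left; exact h
  have h3 := Set.ncard_le_ncard hsub (Set.toFinite _)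
  have h4 := Set.ncard_insert_le s(w1, w2) (G.edgeSet \ {s(y1, w1), s(y2, w2)})
  have hs : ({s(y1, w1), s(y2, w2)} : Set (Sym2 V)) ⊆ G.edgeSet := by
    rintro e (rfl | rfl)
    · exact h1
    · exact h2
  have h5 := Set.ncard_sdiff_add_ncard_of_subset hs (Set.toFinite _)
  rw [Set.ncard_pair hne] at h5
  omega

lemma redG_cls {y1 w1 y2 w2 r1 r2 : V} (hw : w1 ≠ w2) (hc : Cls Δ G) (hΔ : 7 ≤ Δ)
    (hN1 : G.neighborFinset w1 = {r1, y1}) (hN2 : G.neighborFinset w2 = {r2, y2}) :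
    Cls Δ (redG G y1 w1 y2 w2 hw) := by
  set H := redG G y1 w1 y2 w2 hw with hH
  have a1 : ∀ x, G.Adj w1 x ↔ x = r1 ∨ x = y1 := by
    intro x; rw [← SimpleGraph.mem_neighborFinset, hN1]; simp
  have a2 : ∀ x, G.Adj w2 x ↔ x = r2 ∨ x = y2 := by
    intro x; rw [← SimpleGraph.mem_neighborFinset, hN2]; simp
  have b1 : ∀ x, H.Adj w1 x → x = r1 ∨ x = w2 := by
    rintro x (⟨h1, h2, h3⟩ | h)
    · rcases (a1 x).1 h1 with h | rfl
      · exact Or.inl h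
      · exact absurd Sym2.eq_swap h2
    · rw [Sym2.eq_iff] at h
      rcases h with h | h
      · exact Or.inr h.2
      · exact absurd h.1 hw
  have b2 : ∀ x, H.Adj w2 x → x = r2 ∨ x = w1 := by
    rintro x (⟨h1, h2, h3⟩ | h)
    · rcases (a2 x).1 h1 with h | rfl
      · exact Or.inl h
      · exact absurd Sym2.eq_swap h3
    · rw [Sym2.eq_iff] at h
      rcases h with h | h
      · exact absurd h.1.symm hw
      · exact Or.inr h.2
  have b3 : ∀ a b, H.Adj a b → (a ≠ w1 ∨ b ≠ w2) → (a ≠ w2 ∨ b ≠ w1) → G.Adj a b := by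
    rintro a b (h | h) h1 h2
    · exact h.1
    · rw [Sym2.eq_iff] at h
      tauto
  have n1 : H.neighborFinset w1 ⊆ {r1, w2} := by
    intro x hx
    simpa using b1 x (by simpa using hx)
  have n2 : H.neighborFinset w2 ⊆ {r2, w1} := by
    intro x hx
    simpa using b2 x (by simpa using hx)
  have m1 : (H.neighborFinset w1).card ≤ 2 := (Finset.card_le_card n1).trans Finset.card_le_two
  have m2 : (H.neighborFinset w2).card ≤ 2 := (Finset.card_le_card n2).trans Finset.card_le_two
  refine ⟨?_, ?_, ?_⟩
  · intro A
    by_cases hA : w1 ∈ A ∧ w2 ∈ A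
    · set A0 := (A.erase w1).erase w2 with hA0
      have hw2 : w2 ∈ A.erase w1 := Finset.mem_erase.2 ⟨hw.symm, hA.2⟩
      have e1 := Finset.add_sum_erase A (fun v => (H.neighborFinset v ∩ A).card) hA.1
      have e2 := Finset.add_sum_erase (A.erase w1) (fun v => (H.neighborFinset v ∩ A).card) hw2
      have c1 := Finset.card_erase_add_one hA.1
      have c2 := Finset.card_erase_add_one hw2
      rw [← hA0] at e2 c2
      have k1 : (H.neighborFinset w1 ∩ A).card ≤ 2 :=
        (Finset.card_le_card Finset.inter_subset_left).trans m1
      have k2 : (H.neighborFinset w2 ∩ A).card ≤ 2 :=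
        (Finset.card_le_card Finset.inter_subset_left).trans m2
      have k3 : ∑ x ∈ A0, (H.neighborFinset x ∩ A).card ≤
          ∑ x ∈ A0, ((G.neighborFinset x ∩ A0).card + ((if r1 = x then 1 else 0) +
            (if r2 = x then 1 else 0))) := by
        apply Finset.sum_le_sum
        intro x hx
        rw [hA0, Finset.mem_erase, Finset.mem_erase] at hx
        have hss : H.neighborFinset x ∩ A ⊆ (G.neighborFinset x ∩ A0) ∪
            ((if r1 = x then {w1} else ∅) ∪ (if r2 = x then {w2} else ∅)) := by
          intro t ht
          simp only [Finset.mem_inter, SimpleGraph.mem_neighborFinset] at ht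
          rw [Finset.mem_union, Finset.mem_union]
          by_cases h1 : t = w1
          · subst h1
            rcases b1 x ht.1.symm with rfl | rfl
            · right; left; simp
            · exact absurd rfl hx.1
          · by_cases h2 : t = w2
            · subst h2
              rcases b2 x ht.1.symm with rfl | rfl
              · right; right; simp
              · exact absurd rfl hx.2.1
            · left
              simp only [Finset.mem_inter, SimpleGraph.mem_neighborFinset, hA0, Finset.mem_erase]
              exact ⟨b3 x t ht.1 (Or.inl hx.2.1) (Or.inl hx.1), h2, h1, ht.2⟩
        refine (Finset.card_le_card hss).trans ((Finset.card_union_le _ _).trans ?_)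
        refine Nat.add_le_add_left ((Finset.card_union_le _ _).trans ?_) _
        apply Nat.add_le_add
        · split_ifs <;> simp
        · split_ifs <;> simp
      rw [Finset.sum_add_distrib, Finset.sum_add_distrib, Finset.sum_ite_eq, Finset.sum_ite_eq]
        at k3
      have k4 := hc.sp A0
      have k5 : (if r1 ∈ A0 then 1 else 0) ≤ 1 := by split_ifs <;> omega
      have k6 : (if r2 ∈ A0 then 1 else 0) ≤ 1 := by split_ifs <;> omega
      omega
    · refine le_trans (Finset.sum_le_sum fun v hv => Finset.card_le_card ?_) (hc.sp A)
      intro x hx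
      simp only [Finset.mem_inter, SimpleGraph.mem_neighborFinset] at hx ⊢
      refine ⟨b3 v x hx.1 ?_ ?_, hx.2⟩
      · by_contra hcon
        push Not at hcon
        rw [hcon.1] at hv; rw [hcon.2] at hx
        exact hA ⟨hv, hx.2⟩
      · by_contra hcon
        push Not at hcon
        rw [hcon.1] at hv; rw [hcon.2] at hx
        exact hA ⟨hx.2, hv⟩
  · intro x
    rw [← SimpleGraph.card_neighborFinset_eq_degree]
    by_cases h1 : x = w1
    · subst h1; omega
    · by_cases h2 : x = w2
      · subst h2; omega
      · refine le_trans (Finset.card_le_card ?_) (hc.dg x)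
        intro t ht
        simp only [SimpleGraph.mem_neighborFinset] at ht ⊢
        exact b3 x t ht (Or.inl h1) (Or.inl h2)
  · rintro ⟨F, hF, h1, h2⟩
    apply hc.rg
    refine ⟨F, ?_, h1, h2⟩
    have hs : w1 ∉ F.support := by
      intro hs
      have h3 := h2 _ hs
      have h4 : (F.neighborSet w1).ncard ≤ ((({r1, w2} : Finset V)) : Set V).ncard := by
        apply Set.ncard_le_ncard _ (Set.toFinite _)
        intro x hx
        simpa using b1 x (hF hx)
      rw [Set.ncard_coe_finset] at h4
      have := Finset.card_le_two (a := r1) (b := w2)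
      omega
    intro a b hab
    refine b3 a b (hF hab) (Or.inl ?_) (Or.inr ?_)
    · rintro rfl; exact hs ⟨b, hab⟩
    · rintro rfl; exact hs ⟨a, hab.symm⟩

lemma h6_tri (h : Ctx Δ G K) {v y w : V} (hvy : G.Adj v y) (hyw : G.Adj y w) (hwv : w ≠ v)
    (hdy : G.degree y = 2) (hdw : G.degree w = 2) (hvw : G.Adj v w) :
    3 * Δ + 1 ≤ ∑ x ∈ G.neighborFinset v, dK K x := by
  have hN := two_nbrs hdy hvy.symm hyw hwv.symm
  obtain ⟨hk, hd⟩ := h.one_edge hN (h.f1 hdy hdw hyw)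
  rw [Sym2.eq_swap] at hk
  have h1 := h.cu _ _ hk
  have hs : (G.neighborFinset v).erase y ∪ (G.neighborFinset y).erase v ⊆
      (G.neighborFinset v).erase y := by
    rw [hN]
    intro x hx
    simp only [Finset.mem_union, Finset.mem_erase, Finset.mem_insert, Finset.mem_singleton,
      SimpleGraph.mem_neighborFinset] at hx ⊢
    rcases hx with hx | ⟨hx, rfl | rfl⟩
    · exact hx
    · exact absurd rfl hx
    · exact ⟨hyw.ne', hvw⟩
  have h2 := Finset.sum_le_sum_of_subset (f := dK K) hs
  have h3 := Finset.add_sum_erase (G.neighborFinset v) (dK K) (a := y) (by simpa using hvy)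
  omega

lemma h6 (hG : MinC Δ G) (h : Ctx Δ G K) (hn : ¬ ∃ C : Sym2 V → Fin (3 * Δ), ValidOn G K C)
    {v y1 w1 y2 w2 : V} (hy : y1 ≠ y2) (hv1 : G.Adj v y1) (hv2 : G.Adj v y2)
    (hyw1 : G.Adj y1 w1) (hyw2 : G.Adj y2 w2) (hw1 : w1 ≠ v) (hw2 : w2 ≠ v)
    (hdy1 : G.degree y1 = 2) (hdy2 : G.degree y2 = 2)
    (hdw1 : G.degree w1 = 2) (hdw2 : G.degree w2 = 2) :
    3 * Δ + 1 ≤ ∑ x ∈ G.neighborFinset v, dK K x := by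
  by_contra hlt
  push Not at hlt
  have hvw1 : ¬ G.Adj v w1 := fun hh => by
    have := h6_tri h hv1 hyw1 hw1 hdy1 hdw1 hh; omega
  have hvw2 : ¬ G.Adj v w2 := fun hh => by
    have := h6_tri h hv2 hyw2 hw2 hdy2 hdw2 hh; omega
  have hN1 := two_nbrs hdy1 hv1.symm hyw1 hw1.symm
  have hN2 := two_nbrs hdy2 hv2.symm hyw2 hw2.symm
  have hf1 := h.f1 hdy1 hdw1 hyw1
  have hf2 := h.f1 hdy2 hdw2 hyw2
  obtain ⟨hk1, hd1⟩ := h.one_edge hN1 hf1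
  obtain ⟨hk2, hd2⟩ := h.one_edge hN2 hf2
  have hww : w1 ≠ w2 := by
    rintro rfl
    have := (h.one_edge (two_nbrs hdw1 hyw2.symm hyw1.symm hy.symm)
      (by rwa [Sym2.eq_swap])).1
    rw [Sym2.eq_swap] at this
    exact hf2 this
  obtain ⟨r1, hr1, har1, hM1⟩ := other_nbr hdw1 hyw1.symm
  obtain ⟨r2, hr2, har2, hM2⟩ := other_nbr hdw2 hyw2.symm
  rw [Finset.pair_comm] at hM1 hM2
  have hg1 := (h.one_edge hM1 (by rwa [Sym2.eq_swap])).1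
  have hg2 := (h.one_edge hM2 (by rwa [Sym2.eq_swap])).1
  have hr1w2 : r1 ≠ w2 := by
    rintro rfl
    exact h.f1 hdw1 hdw2 har1 hg1
  have hr2w1 : r2 ≠ w1 := by
    rintro rfl
    exact h.f1 hdw2 hdw1 har2 hg2
  have hee : s(y1, w1) ≠ s(y2, w2) := by
    intro hh
    rw [Sym2.eq_iff] at hh
    rcases hh with hh | hh
    · exact hy hh.1
    · rw [hh.2] at hvw1; exact hvw1 hv2
  obtain ⟨C, hC⟩ := hG.mn _ (redG_cls hww h.cls h.hΔ hM1 hM2) (redG_ncard hww hyw1 hyw2 hee)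
  set H := redG G y1 w1 y2 w2 hww with hH
  have hKG : ∀ e ∈ K, e ∈ G.edgeSet := fun e he => by simpa using h.hK he
  have hGH : ∀ e ∈ G.edgeSet, e ≠ s(y1, w1) → e ≠ s(y2, w2) → e ∈ H.edgeSet := by
    intro e
    induction e using Sym2.ind with
    | _ a b => exact fun h1 h2 h3 => Or.inl ⟨h1, h2, h3⟩
  have hKH : ∀ e ∈ K, e ∈ H.edgeSet := by
    intro e he
    refine hGH e (hKG e he) ?_ ?_
    · rintro rfl; exact hf1 he
    · rintro rfl; exact hf2 he
  have hγ : C s(w1, r1) ≠ C s(w2, r2) := by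
    refine hC _ (hKH _ hg1) _ (hKH _ hg2) ⟨?_, Or.inr ⟨s(w1, w2), Or.inr rfl,
      ⟨w1, by simp, by simp⟩, ⟨w2, by simp, by simp⟩⟩⟩
    intro hh
    rw [Sym2.eq_iff] at hh
    rcases hh with hh | hh
    · exact hww hh.1
    · exact hr1w2 hh.2
  set N' := ((G.neighborFinset v).erase y1).erase y2 with hN'
  set B := (N'.biUnion (fun x => K.filter (fun e => x ∈ e))).image C with hB
  have hmem2 : y2 ∈ (G.neighborFinset v).erase y1 := by
    simp [hy.symm, hv2]
  have hBc : B.card + 2 ≤ 3 * Δ := by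
    have h1 : B.card ≤ ∑ x ∈ N', dK K x := Finset.card_image_le.trans Finset.card_biUnion_le
    have h2 := Finset.add_sum_erase (G.neighborFinset v) (dK K) (a := y1) (by simpa using hv1)
    have h3 := Finset.add_sum_erase _ (dK K) hmem2
    rw [← hN'] at h3
    omega
  have hB2 : 1 < Bᶜ.card := by
    rw [Finset.card_compl, Fintype.card_fin]; omega
  obtain ⟨p, hp, q, hq, hpq⟩ := Finset.one_lt_card.1 hB2
  obtain ⟨c1, c2, hc1, hc2, hcc, hcγ1, hcγ2⟩ : ∃ c1 c2 : Fin (3 * Δ), c1 ∉ B ∧ c2 ∉ B ∧ c1 ≠ c2 ∧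
      c1 ≠ C s(w1, r1) ∧ c2 ≠ C s(w2, r2) := by
    rw [Finset.mem_compl] at hp hq
    by_cases hh : p ≠ C s(w1, r1) ∧ q ≠ C s(w2, r2)
    · exact ⟨p, q, hp, hq, hpq, hh.1, hh.2⟩
    · refine ⟨q, p, hq, hp, hpq.symm, ?_, ?_⟩
      · intro h3
        apply hh
        exact ⟨fun h4 => hpq (h4.trans h3.symm), fun h4 => hγ (h3.symm.trans h4)⟩
      · intro h3
        apply hh
        exact ⟨fun h4 => hγ (h4.symm.trans h3), fun h4 => hpq (h3.trans h4.symm)⟩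
  have hne12 : s(y1, v) ≠ s(y2, v) := by
    intro hh
    rw [Sym2.eq_iff] at hh
    rcases hh with hh | hh
    · exact hy hh.1
    · exact hv1.ne' hh.1
  have keyB : ∀ x ∈ N', ∀ e' ∈ K, x ∈ e' → C e' ∈ B := by
    intro x hx e' he' hxe
    rw [hB]
    exact Finset.mem_image_of_mem _ (Finset.mem_biUnion.2
      ⟨x, hx, Finset.mem_filter.2 ⟨he', hxe⟩⟩)
  have key1 : ∀ e' ∈ K, e' ≠ s(y1, v) → e' ≠ s(y2, v) → Conflict G s(y1, v) e' → c1 ≠ C e' := by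
    intro e' he' hn1 hn2 hcf
    obtain ⟨x, hx, hxe⟩ := conflict_incident (hKG e' he') hcf
    rw [hN1] at hx
    simp only [Finset.mem_union, Finset.mem_erase, Finset.mem_insert, Finset.mem_singleton,
      SimpleGraph.mem_neighborFinset] at hx
    rcases hx with ⟨hx, rfl | rfl⟩ | ⟨hx, hx'⟩
    · exact absurd rfl hx
    · rw [h.edge_at hM1 (by rwa [Sym2.eq_swap]) he' hxe]; exact hcγ1
    · by_cases hx2 : x = y2
      · subst hx2
        exact absurd (h.edge_at hN2 hf2 he' hxe) hn2
      · have := keyB x (by simp [hN', hx2, hx, hx']) e' he' hxe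
        rintro rfl
        exact hc1 this
  have key2 : ∀ e' ∈ K, e' ≠ s(y1, v) → e' ≠ s(y2, v) → Conflict G s(y2, v) e' → c2 ≠ C e' := by
    intro e' he' hn1 hn2 hcf
    obtain ⟨x, hx, hxe⟩ := conflict_incident (hKG e' he') hcf
    rw [hN2] at hx
    simp only [Finset.mem_union, Finset.mem_erase, Finset.mem_insert, Finset.mem_singleton,
      SimpleGraph.mem_neighborFinset] at hx
    rcases hx with ⟨hx, rfl | rfl⟩ | ⟨hx, hx'⟩
    · exact absurd rfl hx
    · rw [h.edge_at hM2 (by rwa [Sym2.eq_swap]) he' hxe]; exact hcγ2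
    · by_cases hx2 : x = y1
      · subst hx2
        exact absurd (h.edge_at hN1 hf1 he' hxe) hn1
      · have := keyB x (by simp [hN', hx2, hx, hx']) e' he' hxe
        rintro rfl
        exact hc2 this
  have key3 : ∀ e ∈ K, ∀ e' ∈ K, e ≠ s(y1, v) → e ≠ s(y2, v) → e' ≠ s(y1, v) → e' ≠ s(y2, v) →
      Conflict G e e' → C e ≠ C e' := by
    intro e he e' he' n1 n2 n3 n4 hcf
    refine hC e (hKH e he) e' (hKH e' he') ⟨hcf.1, ?_⟩
    rcases hcf.2 with h1 | ⟨f, hf, ⟨a, ha, hpf⟩, ⟨b, hb, hqf⟩⟩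
    · exact Or.inl h1
    · by_cases hfe : f = s(y1, w1)
      · subst hfe
        rcases Sym2.mem_iff.1 hpf with rfl | rfl
        · exact absurd (h.edge_at hN1 hf1 he ha) n1
        · rcases Sym2.mem_iff.1 hqf with rfl | rfl
          · exact absurd (h.edge_at hN1 hf1 he' hb) n3
          · exact Or.inl ⟨_, ha, hb⟩
      · by_cases hfe2 : f = s(y2, w2)
        · subst hfe2
          rcases Sym2.mem_iff.1 hpf with rfl | rfl
          · exact absurd (h.edge_at hN2 hf2 he ha) n2
          · rcases Sym2.mem_iff.1 hqf with rfl | rfl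
            · exact absurd (h.edge_at hN2 hf2 he' hb) n4
            · exact Or.inl ⟨_, ha, hb⟩
        · exact Or.inr ⟨f, hGH f hf hfe hfe2, ⟨a, ha, hpf⟩, ⟨b, hb, hqf⟩⟩
  apply hn
  refine ⟨fun e => if e = s(y1, v) then c1 else if e = s(y2, v) then c2 else C e, ?_⟩
  intro e he e' he' hcf
  have hne := hcf.1
  by_cases a1 : e = s(y1, v)
  · have b1 : e' ≠ s(y1, v) := fun hh => hne (a1.trans hh.symm)
    by_cases b2 : e' = s(y2, v)
    · simpa [a1, b2, hne12.symm] using hcc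
    · simp only [a1, b1, b2, if_true, if_false]
      exact key1 e' he' b1 b2 (a1 ▸ hcf)
  · by_cases a2 : e = s(y2, v)
    · have b2 : e' ≠ s(y2, v) := fun hh => hne (a2.trans hh.symm)
      by_cases b1 : e' = s(y1, v)
      · simpa [a2, b1, hne12.symm] using hcc.symm
      · simp only [a2, b1, b2, hne12.symm, if_true, if_false]
        exact key2 e' he' b1 b2 (a2 ▸ hcf)
    · by_cases b1 : e' = s(y1, v)
      · simp only [a1, a2, b1, if_true, if_false]
        exact (key1 e he a1 a2 (b1 ▸ hcf.symm)).symm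
      · by_cases b2 : e' = s(y2, v)
        · simp only [a1, a2, b2, hne12.symm, if_true, if_false]
          exact (key2 e he a1 a2 (b2 ▸ hcf.symm)).symm
        · simp only [a1, a2, b1, b2, if_false]
          exact key3 e he e' he' a1 a2 b1 b2 hcf

end part2

section part3
variable {V : Type} [Fintype V]

/-- sum of the `K`-degrees over the neighbourhood -/
noncomputable def Sg (G : SimpleGraph V) (K : Finset (Sym2 V)) (v : V) : ℕ :=
  ∑ x ∈ G.neighborFinset v, dK K x

/-- the context together with the improved bound for two adjacent chains -/
structure Ctx2 (Δ : ℕ) (G : SimpleGraph V) (K : Finset (Sym2 V)) : Prop extends Ctx Δ G K where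
  h6 : ∀ v y1 w1 y2 w2 : V, y1 ≠ y2 → G.Adj v y1 → G.Adj v y2 → G.Adj y1 w1 → G.Adj y2 w2 →
    w1 ≠ v → w2 ≠ v → G.degree y1 = 2 → G.degree y2 = 2 → G.degree w1 = 2 → G.degree w2 = 2 →
    3 * Δ + 1 ≤ Sg G K v
  ne : K.Nonempty

/-- a 3-vertex with a neighbour of degree 2 -/
def P3 (G : SimpleGraph V) (x : V) : Prop := G.degree x = 3 ∧ ∃ t, G.Adj x t ∧ G.degree t = 2

/-- poor vertices -/
def Poor (G : SimpleGraph V) (x : V) : Prop := G.degree x = 2 ∨ P3 G x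

/-- number of non-leaf neighbours -/
noncomputable def Dn (G : SimpleGraph V) (v : V) : ℕ :=
  ((G.neighborFinset v).filter (fun x => G.degree x ≠ 1)).card

/-- number of non-leaf, non-poor neighbours -/
noncomputable def Kn (G : SimpleGraph V) (v : V) : ℕ :=
  ((G.neighborFinset v).filter (fun x => G.degree x ≠ 1 ∧ ¬ Poor G x)).card

/-- number of neighbours of degree 2 -/
noncomputable def Tn (G : SimpleGraph V) (v : V) : ℕ :=
  ((G.neighborFinset v).filter (fun x => G.degree x = 2)).card

def T2 (G : SimpleGraph V) (w : V) : Prop := G.degree w = 3 ∧ 2 ≤ Tn G w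

def W45 (G : SimpleGraph V) (w : V) : Prop := (Dn G w = 4 ∨ Dn G w = 5) ∧ Kn G w ≤ 1

def Gd (G : SimpleGraph V) (v : V) : Prop := 4 ≤ Dn G v ∧ ¬ W45 G v

/-- label of a neighbour `x` of `v` -/
noncomputable def lab (G : SimpleGraph V) (v x : V) : Fin 6 :=
  if G.degree x = 1 then 0 else
    if G.degree x = 2 then
      (if ∃ w, w ≠ v ∧ G.Adj x w ∧ G.degree w = 2 then 4
        else if ∃ w, w ≠ v ∧ G.Adj x w ∧ (T2 G w ∨ W45 G w) then 5 else 3)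
    else if P3 G x then 2 else 1

noncomputable def nn (G : SimpleGraph V) (v : V) (i : Fin 6) : ℕ :=
  ((G.neighborFinset v).filter (fun x => lab G v x = i)).card

lemma lab_cases (G : SimpleGraph V) (v x : V) :
    (lab G v x = 0 ∧ G.degree x = 1) ∨ (lab G v x = 1 ∧ G.degree x ≠ 1 ∧ ¬ Poor G x) ∨
    (lab G v x = 2 ∧ P3 G x) ∨
    (lab G v x = 3 ∧ G.degree x = 2 ∧ (¬ ∃ w, w ≠ v ∧ G.Adj x w ∧ G.degree w = 2) ∧
      (¬ ∃ w, w ≠ v ∧ G.Adj x w ∧ (T2 G w ∨ W45 G w))) ∨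
    (lab G v x = 4 ∧ G.degree x = 2 ∧ ∃ w, w ≠ v ∧ G.Adj x w ∧ G.degree w = 2) ∨
    (lab G v x = 5 ∧ G.degree x = 2 ∧ ∃ w, w ≠ v ∧ G.Adj x w ∧ (T2 G w ∨ W45 G w)) := by
  unfold lab Poor
  split_ifs with h1 h2 h3 h4 h5
  · simp [h1]
  · right; right; right; right; left; exact ⟨rfl, h2, h3⟩
  · right; right; right; right; right; exact ⟨rfl, h2, h4⟩
  · right; right; right; left; exact ⟨rfl, h2, h3, h4⟩
  · right; right; left; exact ⟨rfl, h5⟩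
  · right; left; refine ⟨rfl, h1, ?_⟩; tauto

variable {Δ : ℕ} {G : SimpleGraph V} {K : Finset (Sym2 V)}

lemma sum_lab (v : V) (f : Fin 6 → ℕ) :
    ∑ x ∈ G.neighborFinset v, f (lab G v x) = nn G v 0 * f 0 + nn G v 1 * f 1 + nn G v 2 * f 2
      + nn G v 3 * f 3 + nn G v 4 * f 4 + nn G v 5 * f 5 := by
  rw [← Finset.sum_fiberwise (G.neighborFinset v) (fun x => lab G v x), Fin.sum_univ_six]
  have : ∀ i : Fin 6, ∑ x ∈ (G.neighborFinset v).filter (fun x => lab G v x = i), f (lab G v x)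
      = nn G v i * f i := by
    intro i
    rw [Finset.sum_congr rfl (g := fun _ => f i)]
    · rw [Finset.sum_const, smul_eq_mul]; rfl
    · intro x hx
      rw [(Finset.mem_filter.1 hx).2]
  simp only [this]

lemma card_lab (v : V) (p : V → Prop) [DecidablePred p] (f : Fin 6 → ℕ)
    (h : ∀ x ∈ G.neighborFinset v, (if p x then 1 else 0) = f (lab G v x)) :
    ((G.neighborFinset v).filter p).card = nn G v 0 * f 0 + nn G v 1 * f 1 + nn G v 2 * f 2
      + nn G v 3 * f 3 + nn G v 4 * f 4 + nn G v 5 * f 5 := by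
  rw [← sum_lab, Finset.card_filter]
  exact Finset.sum_congr rfl h

lemma deg_nn (v : V) : G.degree v = nn G v 0 + nn G v 1 + nn G v 2 + nn G v 3 + nn G v 4
    + nn G v 5 := by
  have := sum_lab (G := G) v (fun _ => 1)
  simp only [Finset.sum_const, smul_eq_mul, mul_one, SimpleGraph.card_neighborFinset_eq_degree]
    at this
  exact this

lemma Dn_nn (v : V) : Dn G v = nn G v 1 + nn G v 2 + nn G v 3 + nn G v 4 + nn G v 5 := by
  unfold Dn
  rw [card_lab v _ ![0, 1, 1, 1, 1, 1]]
  · simp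
  · intro x _
    rcases lab_cases G v x with h | h | h | h | h | h
    · simp [h.1, h.2]
    · simp [h.1, h.2.1]
    · simp [h.1, h.2.1]
    · simp [h.1, h.2.1]
    · simp [h.1, h.2.1]
    · simp [h.1, h.2.1]

lemma Kn_nn (v : V) : Kn G v = nn G v 1 := by
  unfold Kn
  rw [card_lab v _ ![0, 1, 0, 0, 0, 0]]
  · simp
  · intro x _
    rcases lab_cases G v x with h | h | h | h | h | h
    · simp [h.1, h.2]
    · simp [h.1, h.2.1, h.2.2]
    · simp [h.1, Poor, h.2]
    · simp [h.1, Poor, h.2.1]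
    · simp [h.1, Poor, h.2.1]
    · simp [h.1, Poor, h.2.1]

lemma Tn_nn (v : V) : Tn G v = nn G v 3 + nn G v 4 + nn G v 5 := by
  unfold Tn
  rw [card_lab v _ ![0, 0, 0, 1, 1, 1]]
  · simp
  · intro x _
    rcases lab_cases G v x with h | h | h | h | h | h
    · simp [h.1, h.2]
    · have : G.degree x ≠ 2 := fun hh => h.2.2 (Or.inl hh)
      simp [h.1, this]
    · simp [h.1, h.2.1]
    · simp [h.1, h.2.1]
    · simp [h.1, h.2.1]
    · simp [h.1, h.2.1]

lemma Sg_le_lab (v : V) (f : Fin 6 → ℕ)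
    (h : ∀ x, G.Adj v x → dK K x ≤ f (lab G v x)) :
    Sg G K v ≤ nn G v 0 * f 0 + nn G v 1 * f 1 + nn G v 2 * f 2
      + nn G v 3 * f 3 + nn G v 4 * f 4 + nn G v 5 * f 5 := by
  rw [← sum_lab]
  exact Finset.sum_le_sum fun x hx => h x (by simpa using hx)

lemma Sg_le_lab' (v o : V) (ho : G.Adj v o) (f : Fin 6 → ℕ)
    (h : ∀ x, G.Adj v x → dK K x ≤ f (lab G v x)) :
    Sg G K v + f (lab G v o) ≤ nn G v 0 * f 0 + nn G v 1 * f 1 + nn G v 2 * f 2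
      + nn G v 3 * f 3 + nn G v 4 * f 4 + nn G v 5 * f 5 + dK K o := by
  have ho' : o ∈ G.neighborFinset v := by simpa using ho
  have h1 := Finset.add_sum_erase _ (dK K) ho'
  have h2 := Finset.add_sum_erase _ (fun x => f (lab G v x)) ho'
  rw [← sum_lab]
  unfold Sg
  have h3 : ∑ x ∈ (G.neighborFinset v).erase o, dK K x ≤
      ∑ x ∈ (G.neighborFinset v).erase o, f (lab G v x) :=
    Finset.sum_le_sum fun x hx => h x (by simpa using (Finset.mem_erase.1 hx).2)
  omega

lemma nn_pos {v x : V} (h : G.Adj v x) {i : Fin 6} (hi : lab G v x = i) : 1 ≤ nn G v i := by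
  apply Finset.card_pos.2
  exact ⟨x, Finset.mem_filter.2 ⟨by simpa using h, hi⟩⟩

lemma poor_pos {v x : V} (h : G.Adj v x) (hp : Poor G x) :
    1 ≤ nn G v 2 + nn G v 3 + nn G v 4 + nn G v 5 := by
  rcases lab_cases G v x with h1 | h1 | h1 | h1 | h1 | h1
  · rcases hp with hp | hp
    · omega
    · have := hp.1; omega
  · exact absurd hp h1.2.2
  · have := nn_pos h h1.1; omega
  · have := nn_pos h h1.1; omega
  · have := nn_pos h h1.1; omega
  · have := nn_pos h h1.1; omega

lemma two_pos {v x : V} (h : G.Adj v x) (hp : G.degree x = 2) :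
    1 ≤ nn G v 3 + nn G v 4 + nn G v 5 := by
  rcases lab_cases G v x with h1 | h1 | h1 | h1 | h1 | h1
  · omega
  · exact absurd (Or.inl hp) h1.2.2
  · have := h1.2.1; omega
  · have := nn_pos h h1.1; omega
  · have := nn_pos h h1.1; omega
  · have := nn_pos h h1.1; omega

lemma Ctx.cs2 (h : Ctx Δ G K) {u v : V} (huv : s(u, v) ∈ K) :
    3 * Δ + dK K u + dK K v ≤ Sg G K u + Sg G K v := by
  have hadj : G.Adj u v := by simpa using h.hK huv
  have h1 := h.cs huv
  have h2 := Finset.add_sum_erase (G.neighborFinset u) (dK K) (a := v) (by simpa using hadj)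
  have h3 := Finset.add_sum_erase (G.neighborFinset v) (dK K) (a := u) (by simpa using hadj.symm)
  unfold Sg
  omega

/-- basic bound from degrees -/
lemma Ctx.b1 (h : Ctx Δ G K) (v : V) : Sg G K v ≤ nn G v 0 + nn G v 1 * Δ + nn G v 2 * 3
    + nn G v 3 * 2 + nn G v 4 * 2 + nn G v 5 * 2 := by
  have := Sg_le_lab (G := G) (K := K) v ![1, Δ, 3, 2, 2, 2] ?_
  · simpa using this
  · intro x _
    have h1 := h.dle x
    have h2 := h.dΔ x
    rcases lab_cases G v x with h3 | h3 | h3 | h3 | h3 | h3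
    · rw [h3.1]; simp; omega
    · rw [h3.1]; simp; omega
    · rw [h3.1]; have := h3.2.1; simp; omega
    · rw [h3.1]; simp; omega
    · rw [h3.1]; simp; omega
    · rw [h3.1]; simp; omega

lemma Ctx.leaf (h : Ctx Δ G K) {v x : V} (hvx : G.Adj v x) (hx : G.degree x = 1) :
    3 * Δ + 1 ≤ Sg G K v := by
  have hN : G.neighborFinset x = {v} := by
    symm
    apply Finset.eq_of_subset_of_card_le
    · intro t ht
      rw [Finset.mem_singleton] at ht
      subst ht; simpa using hvx.symm
    · rw [SimpleGraph.card_neighborFinset_eq_degree, hx, Finset.card_singleton]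
  have hc := h.cov x v hvx.symm
  have hk : s(x, v) ∈ K := by
    have := hc
    rw [dK_eq h.hK] at this
    obtain ⟨t, ht⟩ := Finset.card_pos.1 this
    rw [Finset.mem_filter, hN, Finset.mem_singleton] at ht
    rw [← ht.1]; exact ht.2
  have h1 := h.cs2 hk
  have h2 : Sg G K x = dK K v := by unfold Sg; rw [hN, Finset.sum_singleton]
  omega

lemma Ctx.leaf' (h : Ctx Δ G K) (v : V) : nn G v 0 = 0 ∨ 3 * Δ + 1 ≤ Sg G K v := by
  by_cases h0 : nn G v 0 = 0
  · exact Or.inl h0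
  · right
    obtain ⟨x, hx⟩ := Finset.card_pos.1 (Nat.pos_of_ne_zero h0)
    rw [Finset.mem_filter, SimpleGraph.mem_neighborFinset] at hx
    apply h.leaf hx.1
    rcases lab_cases G v x with h1 | h1 | h1 | h1 | h1 | h1
    · exact h1.2
    all_goals rw [hx.2] at h1; exact absurd h1.1 (by decide)

lemma Ctx.dsum (h : Ctx Δ G K) (v : V) : nn G v 0 + nn G v 1 + nn G v 2 + nn G v 3 + nn G v 4
    + nn G v 5 ≤ Δ := by
  rw [← deg_nn]; exact h.cls.dg v

/-- few non-leaf neighbours: no leaves -/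
lemma Ctx.f0 (h : Ctx Δ G K) {v : V} (hd : 2 ≤ G.degree v) (hD : Dn G v ≤ 2) :
    G.degree v = 2 ∧ Dn G v = 2 ∧ nn G v 0 = 0 := by
  have h1 := deg_nn (G := G) v
  have h2 := Dn_nn (G := G) v
  have h3 := h.b1 v
  have h4 := h.leaf' v
  have h5 := h.dsum v
  have h6 := h.hΔ
  have hk : nn G v 1 ≤ 2 := by omega
  generalize nn G v 1 = k at *
  interval_cases k <;> omega

/-- degree-3 core vertices with a poor neighbour have no leaves -/
lemma Ctx.f0' (h : Ctx Δ G K) {v : V} (hD : Dn G v = 3)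
    (hp : 1 ≤ nn G v 2 + nn G v 3 + nn G v 4 + nn G v 5) : G.degree v = 3 ∧ nn G v 0 = 0 := by
  have h1 := deg_nn (G := G) v
  have h2 := Dn_nn (G := G) v
  have h3 := h.b1 v
  have h4 := h.leaf' v
  have h5 := h.dsum v
  have h6 := h.hΔ
  have hk : nn G v 1 ≤ 2 := by omega
  generalize nn G v 1 = k at *
  interval_cases k <;> omega

lemma Ctx.w45 (h : Ctx Δ G K) {v : V} (hW : W45 G v) :
    nn G v 0 = 0 ∧ G.degree v = Dn G v ∧ Sg G K v ≤ Δ + 12 := by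
  have h1 := deg_nn (G := G) v
  have h2 := Dn_nn (G := G) v
  have h3 := h.b1 v
  have h4 := h.leaf' v
  have h5 := h.dsum v
  have h6 := h.hΔ
  have hk := Kn_nn (G := G) v
  obtain ⟨hW1, hW2⟩ := hW
  rw [hk] at hW2
  generalize nn G v 1 = k at *
  interval_cases k <;> omega

lemma Ctx.good_of (h : Ctx Δ G K) {v x : V} (hvx : G.Adj v x) (hp : Poor G x)
    (hS : 3 * Δ ≤ Sg G K v + 1) : Gd G v := by
  have hp := poor_pos hvx hp
  have h1 := deg_nn (G := G) v
  have h2 := Dn_nn (G := G) v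
  have h3 := h.b1 v
  have h4 := h.leaf' v
  have h5 := h.dsum v
  have h6 := h.hΔ
  constructor
  · by_contra hlt
    have hk : nn G v 1 ≤ 2 := by omega
    generalize nn G v 1 = k at *
    interval_cases k <;> omega
  · intro hW
    have := (h.w45 hW).2.2
    omega

/-- a non-good, non-leaf vertex with a poor neighbour -/
lemma Ctx.nongood (h : Ctx Δ G K) {v x : V} (hvx : G.Adj v x) (hp : Poor G x)
    (hd : G.degree v ≠ 1) (hg : ¬ Gd G v) :
    G.degree v = 2 ∨ G.degree v = 3 ∨ (W45 G v ∧ G.degree v ≤ 5) := by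
  have hpos : 0 < G.degree v := by
    rw [SimpleGraph.degree_pos_iff_exists_adj]; exact ⟨x, hvx⟩
  by_cases hW : W45 G v
  · right; right
    have := (h.w45 hW).2.1
    have := hW.1
    exact ⟨hW, by omega⟩
  · have hD : Dn G v ≤ 3 := by
      by_contra hlt
      exact hg ⟨by omega, hW⟩
    by_cases hD2 : Dn G v ≤ 2
    · exact Or.inl (h.f0 (by omega) hD2).1
    · exact Or.inr (Or.inl (h.f0' (by omega) (poor_pos hvx hp)).1)

lemma W45.deg (h : Ctx Δ G K) {v : V} (hW : W45 G v) : 4 ≤ G.degree v ∧ G.degree v ≤ 5 := by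
  have := (h.w45 hW).2.1
  have := hW.1
  omega

lemma W45.not_gd {v : V} (hW : W45 G v) : ¬ Gd G v := fun h => h.2 hW

lemma Dn_le (v : V) : Dn G v ≤ G.degree v := by
  rw [Dn_nn, deg_nn]; omega

lemma dK_add (hK : K ⊆ G.edgeFinset) {w : V} (T : Finset V) (hT : ∀ x ∈ T, G.Adj w x)
    (hn : ∀ x ∈ T, s(w, x) ∉ K) : dK K w + T.card ≤ G.degree w := by
  rw [dK_eq hK, ← Finset.card_union_of_disjoint, ← SimpleGraph.card_neighborFinset_eq_degree]
  · apply Finset.card_le_card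
    intro x hx
    rw [Finset.mem_union, Finset.mem_filter] at hx
    rcases hx with hx | hx
    · exact hx.1
    · simpa using hT x hx
  · rw [Finset.disjoint_left]
    intro x hx hx'
    exact hn x hx' (Finset.mem_filter.1 hx).2

/-- `K`-degree drops when an edge is not in `K` -/
lemma dK_lt (hK : K ⊆ G.edgeFinset) {w x : V} (hx : G.Adj w x) (hn : s(w, x) ∉ K) :
    dK K w + 1 ≤ G.degree w := by
  have := dK_add hK {x} (by simpa using hx) (by simpa using hn)
  simpa using this

lemma dK_lt' (hK : K ⊆ G.edgeFinset) {w x : V} (hx : G.Adj w x) (hn : s(w, x) ∉ K) :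
    dK K x + 1 ≤ G.degree x :=
  dK_lt hK hx.symm (by rwa [Sym2.eq_swap])

lemma Sg_two {y v w : V} (hN : G.neighborFinset y = {v, w}) (h : w ≠ v) :
    Sg G K y = dK K v + dK K w := by
  unfold Sg; rw [hN, Finset.sum_pair h.symm]

lemma three_nbrs {z x : V} (hd : G.degree z = 3) (hx : G.Adj z x) :
    ∃ a b, a ≠ b ∧ a ≠ x ∧ b ≠ x ∧ G.Adj z a ∧ G.Adj z b ∧ G.neighborFinset z = {x, a, b} ∧
      Sg G K z = dK K x + dK K a + dK K b := by
  have hx' : x ∈ G.neighborFinset z := by simpa using hx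
  have hc : ((G.neighborFinset z).erase x).card = 2 := by
    rw [Finset.card_erase_of_mem hx', SimpleGraph.card_neighborFinset_eq_degree, hd]
  obtain ⟨a, b, hab, hN⟩ := Finset.card_eq_two.1 hc
  have ha : a ∈ (G.neighborFinset z).erase x := by rw [hN]; simp
  have hb : b ∈ (G.neighborFinset z).erase x := by rw [hN]; simp
  rw [Finset.mem_erase, SimpleGraph.mem_neighborFinset] at ha hb
  refine ⟨a, b, hab, ha.1, hb.1, ha.2, hb.2, ?_, ?_⟩
  · rw [← hN, Finset.insert_erase hx']
  · unfold Sg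
    rw [← Finset.add_sum_erase _ _ hx', hN, Finset.sum_pair hab, add_assoc]

lemma mem3 {z x a b t : V} (hN : G.neighborFinset z = {x, a, b}) (ht : G.Adj z t) :
    t = x ∨ t = a ∨ t = b := by
  rw [← SimpleGraph.mem_neighborFinset, hN] at ht
  simpa using ht

/-- a vertex with an edge has a `K`-edge -/
lemma Ctx.cov' (h : Ctx Δ G K) {x y : V} (hxy : G.Adj x y) (hall : ∀ t, G.Adj x t → s(x, t) ∉ K) :
    False := by
  have h1 := h.cov x y hxy
  rw [dK_eq h.hK] at h1
  obtain ⟨t, ht⟩ := Finset.card_pos.1 h1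
  rw [Finset.mem_filter, SimpleGraph.mem_neighborFinset] at ht
  exact hall t ht.1 ht.2

end part3

section part4
variable {V : Type} [Fintype V] {Δ : ℕ} {G : SimpleGraph V} {K : Finset (Sym2 V)}

lemma two_le_Tn {w x y : V} (hxy : x ≠ y) (hx : G.Adj w x) (hy : G.Adj w y)
    (hdx : G.degree x = 2) (hdy : G.degree y = 2) : 2 ≤ Tn G w := by
  have : ({x, y} : Finset V).card ≤ Tn G w := by
    apply Finset.card_le_card
    intro t ht
    rw [Finset.mem_insert, Finset.mem_singleton] at ht
    rw [Finset.mem_filter, SimpleGraph.mem_neighborFinset]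
    rcases ht with rfl | rfl
    · exact ⟨hx, hdx⟩
    · exact ⟨hy, hdy⟩
  rwa [Finset.card_pair hxy] at this

lemma T2.struct {w : V} (hT : T2 G w) {y : V} (hy : G.Adj w y) :
    ∃ y' r, y' ≠ y ∧ r ≠ y ∧ y' ≠ r ∧ G.Adj w y' ∧ G.Adj w r ∧ G.degree y' = 2 ∧
      G.neighborFinset w = {y, y', r} ∧ Sg G K w = dK K y + dK K y' + dK K r := by
  obtain ⟨a, b, hab, hax, hbx, ha, hb, hN, hS⟩ := three_nbrs (K := K) hT.1 hy
  have h2 : 1 < ((G.neighborFinset w).filter (fun x => G.degree x = 2)).card := hT.2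
  obtain ⟨y', hy', hne⟩ := Finset.exists_mem_ne h2 y
  rw [Finset.mem_filter, SimpleGraph.mem_neighborFinset] at hy'
  rcases mem3 hN hy'.1 with h3 | h3 | h3
  · exact absurd h3 hne
  · subst h3
    exact ⟨y', b, hax, hbx, hab, ha, hb, hy'.2, hN, hS⟩
  · subst h3
    exact ⟨y', a, hbx, hax, hab.symm, hb, ha, hy'.2, by rw [hN, Finset.pair_comm], by omega⟩

lemma Ctx.t2 (h : Ctx Δ G K) {w y : V} (hT : T2 G w) (hy : G.Adj w y) (hdy : G.degree y = 2) :
    s(w, y) ∉ K := by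
  intro hk
  obtain ⟨y', r, -, -, -, -, -, hdy', -, hS⟩ := hT.struct (K := K) hy
  obtain ⟨v, hv, -, hN⟩ := other_nbr hdy hy.symm
  have h1 := Sg_two (K := K) hN hv
  have h2 := h.cs2 hk
  have h3 := h.dle y'
  have h4 := h.dΔ r
  have h5 := h.dΔ v
  have := h.hΔ
  omega

lemma Ctx.t2_dK (h : Ctx Δ G K) {w : V} (hT : T2 G w) : dK K w ≤ 1 := by
  have := dK_add h.hK (w := w) ((G.neighborFinset w).filter (fun x => G.degree x = 2)) ?_ ?_
  · have h1 := hT.1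
    have h2 := hT.2
    unfold Tn at h2
    omega
  · intro x hx
    rw [Finset.mem_filter, SimpleGraph.mem_neighborFinset] at hx
    exact hx.1
  · intro x hx
    rw [Finset.mem_filter, SimpleGraph.mem_neighborFinset] at hx
    exact h.t2 hT hx.1 hx.2

lemma Ctx.w45_a (h : Ctx Δ G K) {w o x : V} (hW : W45 G w) (ho : G.Adj w o) (hdo : G.degree o = 3)
    (hx : G.Adj o x) (hdx : G.degree x = 2) : s(o, x) ∉ K := by
  intro hk
  obtain ⟨a, b, hab, hax, hbx, ha, hb, hN, hS⟩ := three_nbrs (K := K) hdo hx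
  obtain ⟨v, hv, -, hM⟩ := other_nbr hdx hx.symm
  have h1 := Sg_two (K := K) hM hv
  have h2 := h.cs2 hk
  have h3 := h.dle w
  have hw := hW.deg h
  have h4 := h.dΔ a
  have h6 := h.dΔ b
  have h5 := h.dΔ v
  have := h.hΔ
  rcases mem3 hN ho.symm with rfl | rfl | rfl <;> omega

lemma Ctx.w45_a' (h : Ctx Δ G K) {w o : V} (hW : W45 G w) (ho : G.Adj w o) (hp : P3 G o) :
    dK K o ≤ 2 := by
  obtain ⟨hd, x, hx, hdx⟩ := hp
  have := dK_lt h.hK hx (h.w45_a hW ho hd hx hdx)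
  omega

lemma Ctx.w45_b (h : Ctx Δ G K) {w o : V} (hW : W45 G w) (ho : G.Adj w o) (hdo : G.degree o = 2) :
    s(w, o) ∉ K := by
  intro hk
  have h0 := h.w45 hW
  have h1 := Sg_le_lab' (K := K) w o ho ![1, Δ, 2, 2, 2, 2] (by
    intro x hx
    have h1 := h.dle x
    have h2 := h.dΔ x
    rcases lab_cases G w x with h3 | h3 | h3 | h3 | h3 | h3
    · rw [h3.1]; simp; omega
    · rw [h3.1]; simp; omega
    · rw [h3.1]; have := h.w45_a' hW hx h3.2; simpa
    · rw [h3.1]; simp; omega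
    · rw [h3.1]; simp; omega
    · rw [h3.1]; simp; omega)
  have hl : (![1, Δ, 2, 2, 2, 2] : Fin 6 → ℕ) (lab G w o) = 2 := by
    rcases lab_cases G w o with h3 | h3 | h3 | h3 | h3 | h3
    · omega
    · exact absurd (Or.inl hdo) h3.2.2
    all_goals rw [h3.1]; simp
  rw [hl] at h1
  simp only [Matrix.cons_val] at h1
  obtain ⟨v, hv, -, hM⟩ := other_nbr hdo ho.symm
  have h2 := Sg_two (K := K) hM hv
  have h3 := h.cs2 hk
  have h4 := h.dΔ v
  have h5 := h.hΔ
  obtain ⟨hW1, hW2⟩ := hW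
  rw [Kn_nn] at hW2
  rw [Dn_nn] at hW1
  generalize nn G w 1 = k at *
  interval_cases k <;> omega

lemma Ctx.w45_b' (h : Ctx Δ G K) {w o : V} (hW : W45 G w) (ho : G.Adj w o)
    (hdo : G.degree o = 2) : dK K o ≤ 1 := by
  have := dK_lt' h.hK ho (h.w45_b hW ho hdo)
  omega

lemma Ctx.w45_c (h : Ctx Δ G K) {w y o : V} (hW : W45 G w) (hy : G.Adj w y)
    (hdy : G.degree y = 2) (ho : G.Adj w o) (hp : P3 G o) : s(w, o) ∉ K := by
  intro hk
  have h0 := h.w45 hW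
  have h1 := Sg_le_lab' (K := K) w o ho ![1, Δ, 2, 1, 1, 1] (by
    intro x hx
    have h1 := h.dle x
    have h2 := h.dΔ x
    rcases lab_cases G w x with h3 | h3 | h3 | h3 | h3 | h3
    · rw [h3.1]; simp; omega
    · rw [h3.1]; simp; omega
    · rw [h3.1]; have := h.w45_a' hW hx h3.2; simpa
    · rw [h3.1]; have := h.w45_b' hW hx h3.2.1; simpa
    · rw [h3.1]; have := h.w45_b' hW hx h3.2.1; simpa
    · rw [h3.1]; have := h.w45_b' hW hx h3.2.1; simpa)
  have hl : (![1, Δ, 2, 1, 1, 1] : Fin 6 → ℕ) (lab G w o) = 2 := by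
    have := hp.1
    rcases lab_cases G w o with h3 | h3 | h3 | h3 | h3 | h3
    · omega
    · exact absurd (Or.inr hp) h3.2.2
    · rw [h3.1]; simp
    all_goals have := h3.2.1; omega
  rw [hl] at h1
  simp only [Matrix.cons_val] at h1
  have ht := two_pos hy hdy
  obtain ⟨hdo, x, hx, hdx⟩ := hp
  obtain ⟨a, b, hab, hax, hbx, ha, hb, hN, hS⟩ := three_nbrs (K := K) hdo hx
  have h7 := dK_lt' h.hK hx (h.w45_a hW ho hdo hx hdx)
  have h3 := h.cs2 hk
  have h4 := h.dΔ a
  have h8 := h.dΔ b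
  have h5 := h.hΔ
  have hw := hW.deg h
  have hs : Sg G K o ≤ dK K w + 1 + Δ := by
    rcases mem3 hN ho.symm with rfl | rfl | rfl <;> omega
  obtain ⟨hW1, hW2⟩ := hW
  rw [Kn_nn] at hW2
  rw [Dn_nn] at hW1
  generalize nn G w 1 = k at *
  interval_cases k <;> omega

lemma Ctx.w45_dK (h : Ctx Δ G K) {w y : V} (hW : W45 G w) (hy : G.Adj w y)
    (hdy : G.degree y = 2) : dK K w ≤ 1 := by
  have h1 := dK_add h.hK (w := w) ((G.neighborFinset w).filter (fun x => Poor G x)) ?_ ?_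
  · have h2 : ((G.neighborFinset w).filter (fun x => Poor G x)).card =
        nn G w 2 + nn G w 3 + nn G w 4 + nn G w 5 := by
      rw [card_lab w _ ![0, 0, 1, 1, 1, 1]]
      · simp
      · intro x _
        rcases lab_cases G w x with h | h | h | h | h | h
        · have : ¬ Poor G x := by
            rintro (h3 | h3)
            · omega
            · have := h3.1; omega
          simp [h.1, this]
        · simp [h.1, h.2.2]
        · simp [h.1, Poor, h.2]
        · simp [h.1, Poor, h.2.1]
        · simp [h.1, Poor, h.2.1]
        · simp [h.1, Poor, h.2.1]
    have h3 := deg_nn (G := G) w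
    have h4 := (h.w45 hW).1
    have h5 := hW.2
    rw [Kn_nn] at h5
    omega
  · intro x hx
    rw [Finset.mem_filter, SimpleGraph.mem_neighborFinset] at hx
    exact hx.1
  · intro x hx
    rw [Finset.mem_filter, SimpleGraph.mem_neighborFinset] at hx
    rcases hx.2 with h1 | h1
    · exact h.w45_b hW hx.1 h1
    · exact h.w45_c hW hy hdy hx.1 h1

def WK (G : SimpleGraph V) (w : V) : Prop := G.degree w = 2 ∨ T2 G w ∨ W45 G w

lemma Ctx.f4 (h : Ctx Δ G K) {y v w : V} (hd : G.degree y = 2) (hv : G.Adj y v)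
    (hw : G.Adj y w) (hne : w ≠ v) (hW : WK G w) :
    s(y, w) ∉ K ∧ dK K w ≤ 1 ∧ dK K y = 1 ∧ 3 * Δ ≤ Sg G K v ∧ Gd G v := by
  have h1 : s(y, w) ∉ K := by
    rcases hW with hW | hW | hW
    · exact h.f1 hd hW hw
    · rw [Sym2.eq_swap]; exact h.t2 hW hw.symm hd
    · rw [Sym2.eq_swap]; exact h.w45_b hW hw.symm hd
  have h2 : dK K w ≤ 1 := by
    rcases hW with hW | hW | hW
    · have := dK_lt' h.hK hw h1
      omega
    · exact h.t2_dK hW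
    · exact h.w45_dK hW hw.symm hd
  have hN := two_nbrs hd hv hw hne.symm
  obtain ⟨h3, h4⟩ := h.one_edge hN h1
  have h5 := h.cs2 h3
  have h6 := Sg_two (K := K) hN hne
  have h7 : 3 * Δ ≤ Sg G K v := by omega
  exact ⟨h1, h2, h4, h7, h.good_of hv.symm (Or.inl hd) (by omega)⟩

lemma Ctx.lab45 (h : Ctx Δ G K) {v x : V} (hx : G.Adj v x)
    (hl : lab G v x = 4 ∨ lab G v x = 5) : dK K x = 1 ∧ 3 * Δ ≤ Sg G K v := by
  have : G.degree x = 2 ∧ ∃ w, w ≠ v ∧ G.Adj x w ∧ WK G w := by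
    rcases lab_cases G v x with h1 | h1 | h1 | h1 | h1 | h1
    · rw [h1.1] at hl; exact absurd hl (by decide)
    · rw [h1.1] at hl; exact absurd hl (by decide)
    · rw [h1.1] at hl; exact absurd hl (by decide)
    · rw [h1.1] at hl; exact absurd hl (by decide)
    · obtain ⟨w, h2, h3, h4⟩ := h1.2.2
      exact ⟨h1.2.1, w, h2, h3, Or.inl h4⟩
    · obtain ⟨w, h2, h3, h4⟩ := h1.2.2
      exact ⟨h1.2.1, w, h2, h3, Or.inr h4⟩
  obtain ⟨hd, w, h2, h3, h4⟩ := this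
  have := h.f4 hd hx.symm h3 h2 h4
  exact ⟨this.2.2.1, this.2.2.2.1⟩

lemma Ctx.s_pos (h : Ctx Δ G K) {v : V} (hs : 1 ≤ nn G v 4 + nn G v 5) : 3 * Δ ≤ Sg G K v := by
  have : ∃ x, G.Adj v x ∧ (lab G v x = 4 ∨ lab G v x = 5) := by
    rcases Nat.eq_zero_or_pos (nn G v 4) with h0 | h0
    · have h1 : 0 < nn G v 5 := by omega
      obtain ⟨x, hx⟩ := Finset.card_pos.1 h1
      rw [Finset.mem_filter, SimpleGraph.mem_neighborFinset] at hx
      exact ⟨x, hx.1, Or.inr hx.2⟩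
    · obtain ⟨x, hx⟩ := Finset.card_pos.1 h0
      rw [Finset.mem_filter, SimpleGraph.mem_neighborFinset] at hx
      exact ⟨x, hx.1, Or.inl hx.2⟩
  obtain ⟨x, hx, hl⟩ := this
  exact (h.lab45 hx hl).2

lemma Ctx.b2 (h : Ctx Δ G K) (v : V) : Sg G K v ≤ nn G v 0 + nn G v 1 * Δ + nn G v 2 * 3
    + nn G v 3 * 2 + nn G v 4 + nn G v 5 := by
  have := Sg_le_lab (G := G) (K := K) v ![1, Δ, 3, 2, 1, 1] ?_
  · simpa using this
  · intro x hx
    have h1 := h.dle x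
    have h2 := h.dΔ x
    rcases lab_cases G v x with h3 | h3 | h3 | h3 | h3 | h3
    · rw [h3.1]; simp; omega
    · rw [h3.1]; simp; omega
    · rw [h3.1]; have := h3.2.1; simp; omega
    · rw [h3.1]; simp; omega
    · have := (h.lab45 hx (Or.inl h3.1)).1; rw [h3.1]; simp; omega
    · have := (h.lab45 hx (Or.inr h3.1)).1; rw [h3.1]; simp; omega

lemma Ctx2.s1_le (h : Ctx2 Δ G K) {v : V} (h2 : 2 ≤ nn G v 4) : 3 * Δ + 1 ≤ Sg G K v := by
  obtain ⟨y1, hy1, y2, hy2, hne⟩ := Finset.one_lt_card.1 (show 1 < _ from h2)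
  rw [Finset.mem_filter, SimpleGraph.mem_neighborFinset] at hy1 hy2
  have key : ∀ y, lab G v y = 4 → G.degree y = 2 ∧ ∃ w, w ≠ v ∧ G.Adj y w ∧ G.degree w = 2 := by
    intro y hl
    rcases lab_cases G v y with h1 | h1 | h1 | h1 | h1 | h1
    · rw [h1.1] at hl; exact absurd hl (by decide)
    · rw [h1.1] at hl; exact absurd hl (by decide)
    · rw [h1.1] at hl; exact absurd hl (by decide)
    · rw [h1.1] at hl; exact absurd hl (by decide)
    · exact h1.2
    · rw [h1.1] at hl; exact absurd hl (by decide)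
  obtain ⟨d1, w1, a1, b1, c1⟩ := key y1 hy1.2
  obtain ⟨d2, w2, a2, b2, c2⟩ := key y2 hy2.2
  exact h.h6 v y1 w1 y2 w2 hne hy1.1 hy2.1 b1 b2 a1 a2 d1 d2 c1 c2

/-- Final charge of good vertices -/
lemma Ctx2.good_charge (h : Ctx2 Δ G K) {v : V} (hg : Gd G v) :
    12 ≤ 4 * nn G v 1 + 2 * nn G v 2 + 2 * nn G v 3 + nn G v 5 ∧
    (4 * nn G v 1 + 2 * nn G v 2 + 2 * nn G v 3 + nn G v 5 = 12 → nn G v 5 = 0) := by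
  have h1 := deg_nn (G := G) v
  have h2 := Dn_nn (G := G) v
  have h3 := h.b2 v
  have h4 := h.leaf' v
  have h5 := h.dsum v
  have h6 := h.hΔ
  have hk := Kn_nn (G := G) v
  obtain ⟨hD, hW⟩ := hg
  have hW' : (Dn G v = 4 ∨ Dn G v = 5) → 2 ≤ Kn G v := by
    intro hh
    by_contra hlt
    exact hW ⟨hh, by omega⟩
  have h7 : nn G v 4 ≤ 1 ∨ 3 * Δ + 1 ≤ Sg G K v := by
    by_cases h8 : nn G v 4 ≤ 1
    · exact Or.inl h8
    · exact Or.inr (h.s1_le (by omega))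
  have h8 : nn G v 4 + nn G v 5 = 0 ∨ 3 * Δ ≤ Sg G K v := by
    by_cases h9 : nn G v 4 + nn G v 5 = 0
    · exact Or.inl h9
    · exact Or.inr (h.s_pos (by omega))
  by_cases hk3 : 3 ≤ nn G v 1
  · omega
  · generalize nn G v 1 = k at *
    interval_cases k <;> omega

lemma T2.p3 {w : V} (hT : T2 G w) : P3 G w := by
  refine ⟨hT.1, ?_⟩
  have h2 : 0 < Tn G w := by have := hT.2; omega
  obtain ⟨x, hx⟩ := Finset.card_pos.1 h2
  rw [Finset.mem_filter, SimpleGraph.mem_neighborFinset] at hx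
  exact ⟨x, hx⟩

lemma Ctx.t2_good (h : Ctx Δ G K) {w : V} (hT : T2 G w) : ∃ r, G.Adj w r ∧ Gd G r := by
  obtain ⟨-, y, hy, hdy⟩ := hT.p3
  obtain ⟨y', r, h1, h2, h3, hy', hr, hdy', hN, hS⟩ := hT.struct (K := K) hy
  have hk1 := h.t2 hT hy hdy
  have hk2 := h.t2 hT hy' hdy'
  have hk : s(w, r) ∈ K := by
    by_contra hk
    apply h.cov' hy
    intro t ht
    rcases mem3 hN ht with rfl | rfl | rfl
    · exact hk1
    · exact hk2
    · exact hk
  refine ⟨r, hr, h.good_of hr.symm (Or.inr hT.p3) ?_⟩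
  have h4 := dK_lt' h.hK hy hk1
  have h5 := dK_lt' h.hK hy' hk2
  have h6 := h.cs2 hk
  have h7 := h.cov w y hy
  omega

/-- a P3 vertex has no leaf neighbours -/
lemma Ctx.p3_noleaf (h : Ctx Δ G K) {z a : V} (hd : G.degree z = 3) (ha : G.Adj z a) :
    G.degree a ≠ 1 := by
  intro h1
  have h2 : 1 ≤ nn G z 0 := by
    apply nn_pos ha
    unfold lab; simp [h1]
  have h3 := deg_nn (G := G) z
  have h4 := Dn_nn (G := G) z
  have := (h.f0 (v := z) (by omega) (by omega)).1
  omega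

lemma Ctx.p3_aux (h : Ctx Δ G K) {z x a b : V} (hd : G.degree z = 3) (hx : G.Adj z x)
    (hdx : G.degree x = 2)
    (hS : Sg G K z = dK K x + dK K a + dK K b) (hx1 : dK K x ≤ 1) (ha : G.Adj z a)
    (hb : G.degree b ≤ 5) (hda : G.degree a = 3 ∨ W45 G a) : s(z, a) ∉ K := by
  intro hk
  have h1 := h.cs2 hk
  have h2 := h.dle b
  have h6 := h.hΔ
  rcases hda with hda | hW
  · obtain ⟨p, q, -, -, -, -, -, -, hS'⟩ := three_nbrs (K := K) hda ha.symm
    have h3 := h.dΔ p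
    have h4 := h.dΔ q
    omega
  · have hp3 : P3 G z := ⟨hd, x, hx, hdx⟩
    have h0 := h.w45 hW
    have h3 := Sg_le_lab' (K := K) a z ha.symm ![1, Δ, 2, 2, 2, 2] (by
      intro x hx
      have h1 := h.dle x
      have h2 := h.dΔ x
      rcases lab_cases G a x with h3 | h3 | h3 | h3 | h3 | h3
      · rw [h3.1]; simp; omega
      · rw [h3.1]; simp; omega
      · rw [h3.1]; have := h.w45_a' hW hx h3.2; simpa
      · rw [h3.1]; simp; omega
      · rw [h3.1]; simp; omega
      · rw [h3.1]; simp; omega)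
    have hl : (![1, Δ, 2, 2, 2, 2] : Fin 6 → ℕ) (lab G a z) = 2 := by
      rcases lab_cases G a z with h3 | h3 | h3 | h3 | h3 | h3
      · omega
      · exact absurd (Or.inr hp3) h3.2.2
      all_goals rw [h3.1]; simp
    rw [hl] at h3
    simp only [Matrix.cons_val] at h3
    obtain ⟨hW1, hW2⟩ := hW
    rw [Kn_nn] at hW2
    rw [Dn_nn] at hW1
    generalize nn G a 1 = k at *
    interval_cases k <;> omega

lemma Ctx.p3_good (h : Ctx Δ G K) {z : V} (hp : P3 G z) : ∃ g, G.Adj z g ∧ Gd G g := by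
  by_cases hT : T2 G z
  · exact h.t2_good hT
  · obtain ⟨hd, x, hx, hdx⟩ := hp
    obtain ⟨a, b, hab, hax, hbx, ha, hb, hN, hS⟩ := three_nbrs (K := K) hd hx
    by_contra hno
    push Not at hno
    have h2 : ∀ t, G.Adj z t → t ≠ x → G.degree t ≠ 2 := by
      intro t ht hne h2
      exact hT ⟨hd, two_le_Tn hne ht hx h2 hdx⟩
    have key : ∀ t, G.Adj z t → t ≠ x → G.degree t = 3 ∨ (W45 G t ∧ G.degree t ≤ 5) := by
      intro t ht hne
      have h3 := h.nongood ht.symm (Or.inr ⟨hd, x, hx, hdx⟩) (h.p3_noleaf hd ht) (hno t ht)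
      have := h2 t ht hne
      tauto
    have ka := key a ha hax
    have kb := key b hb hbx
    have da : G.degree a ≤ 5 := by omega
    have db : G.degree b ≤ 5 := by omega
    have hkx : s(z, x) ∉ K := by
      intro hk
      have h3 := h.cs2 hk
      obtain ⟨v, hv, -, hM⟩ := other_nbr hdx hx.symm
      have h4 := Sg_two (K := K) hM hv
      have h5 := h.dle a
      have h6 := h.dle b
      have h7 := h.dΔ v
      have := h.hΔ
      omega
    have hx1 := dK_lt' h.hK hx hkx
    apply h.cov' hx
    intro t ht
    rcases mem3 hN ht with rfl | rfl | rfl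
    · exact hkx
    · exact h.p3_aux hd hx hdx hS (by omega) ha db (by tauto)
    · exact h.p3_aux (b := a) hd hx hdx (by omega) (by omega) hb da (by tauto)

end part4

section part5
variable {V : Type} [Fintype V] {Δ : ℕ} {G : SimpleGraph V} {K : Finset (Sym2 V)}

/-- what a non-good vertex gives to each neighbour of degree 2 -/
noncomputable def cg (G : SimpleGraph V) (v : V) : ℕ :=
  if P3 G v then (if T2 G v then 1 else 2) else if W45 G v then 1 else 0

/-- charge given by `v` to its neighbour `x` -/
noncomputable def gv (G : SimpleGraph V) (v x : V) : ℕ :=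
  if Gd G v then (![0, 0, 2, 2, 4, 3] : Fin 6 → ℕ) (lab G v x)
  else if G.degree x = 2 then cg G v else 0

noncomputable def give (G : SimpleGraph V) (v : V) : ℕ := ∑ x ∈ G.neighborFinset v, gv G v x

noncomputable def recv (G : SimpleGraph V) (x : V) : ℕ := ∑ v ∈ G.neighborFinset x, gv G v x

lemma give_good {v : V} (hg : Gd G v) :
    give G v = 2 * nn G v 2 + 2 * nn G v 3 + 4 * nn G v 4 + 3 * nn G v 5 := by
  unfold give gv
  simp only [hg, if_true]
  rw [sum_lab]
  simp
  ring

lemma give_non {v : V} (hg : ¬ Gd G v) : give G v = Tn G v * cg G v := by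
  unfold give gv
  simp only [hg, if_false]
  rw [← Finset.sum_filter, Finset.sum_const, smul_eq_mul]
  rfl

lemma gv_le_recv {v x : V} (h : G.Adj x v) : gv G v x ≤ recv G x := by
  unfold recv
  exact Finset.single_le_sum (f := fun v => gv G v x) (fun _ _ => Nat.zero_le _)
    (by simpa using h)

lemma gv_good_p3 {v x : V} (hg : Gd G v) (hx : P3 G x) : gv G v x = 2 := by
  have hd := hx.1
  unfold gv
  simp only [hg, if_true]
  rcases lab_cases G v x with h3 | h3 | h3 | h3 | h3 | h3
  · omega
  · exact absurd (Or.inr hx) h3.2.2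
  · rw [h3.1]; simp
  all_goals have := h3.2.1; omega

lemma Ctx.not_gd_three {v : V} (hd : G.degree v ≤ 3) : ¬ Gd G v := by
  intro hg
  have := hg.1
  have := Dn_le (G := G) v
  omega

lemma Ctx.wk_cases (h : Ctx Δ G K) {v x : V} (hx : G.Adj v x) (hdx : G.degree x = 2)
    (hd : G.degree v ≠ 1) : Gd G v ∨ WK G v ∨ (P3 G v ∧ ¬ T2 G v) := by
  by_cases hg : Gd G v
  · exact Or.inl hg
  · right
    rcases h.nongood hx (Or.inl hdx) hd hg with h1 | h1 | h1
    · exact Or.inl (Or.inl h1)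
    · by_cases hT : T2 G v
      · exact Or.inl (Or.inr (Or.inl hT))
      · exact Or.inr ⟨⟨h1, x, hx, hdx⟩, hT⟩
    · exact Or.inl (Or.inr (Or.inr h1.1))

lemma Ctx.gv_nwk (h : Ctx Δ G K) {v x : V} (hx : G.Adj v x) (hdx : G.degree x = 2)
    (hd : G.degree v ≠ 1) (hW : ¬ WK G v) : 2 ≤ gv G v x := by
  rcases h.wk_cases hx hdx hd with hg | hg | hg
  · unfold gv
    simp only [hg, if_true]
    rcases lab_cases G v x with h3 | h3 | h3 | h3 | h3 | h3
    · omega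
    · exact absurd (Or.inl hdx) h3.2.2
    all_goals rw [h3.1]; simp
  · exact absurd hg hW
  · have : ¬ Gd G v := Ctx.not_gd_three (by have := hg.1.1; omega)
    unfold gv cg
    simp [this, hdx, hg.1, hg.2]

lemma Ctx.not_p3_w45 (h : Ctx Δ G K) {w : V} (hW : W45 G w) : ¬ P3 G w := by
  intro hp
  have := hp.1
  have := hW.deg h
  omega

lemma Ctx.two_pair (h : Ctx Δ G K) {y a b : V} (hdy : G.degree y = 2) (ha : G.Adj y a)
    (hb : G.Adj y b) (hne : b ≠ a) (hW : WK G b) : 4 ≤ gv G a y + gv G b y := by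
  have hg := (h.f4 hdy ha hb hne hW).2.2.2.2
  have hN := two_nbrs hdy ha hb hne.symm
  have hu : ∀ w, w ≠ a → G.Adj y w → w = b := by
    intro w h1 h2
    rw [← SimpleGraph.mem_neighborFinset, hN] at h2
    simp only [Finset.mem_insert, Finset.mem_singleton] at h2
    tauto
  have h1 : 3 ≤ gv G a y ∧ (G.degree b = 2 → 4 ≤ gv G a y) := by
    unfold gv
    simp only [hg, if_true]
    rcases lab_cases G a y with h3 | h3 | h3 | h3 | h3 | h3
    · omega
    · exact absurd (Or.inl hdy) h3.2.2
    · have := h3.2.1; omega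
    · exfalso
      rcases hW with hW | hW
      · exact h3.2.2.1 ⟨b, hne, hb, hW⟩
      · exact h3.2.2.2 ⟨b, hne, hb, hW⟩
    · rw [h3.1]; simp
    · rw [h3.1]
      refine ⟨by simp, ?_⟩
      intro h5
      obtain ⟨w, h6, h7, h8⟩ := h3.2.2
      rw [hu w h6 h7] at h8
      exfalso
      rcases h8 with h8 | h8
      · have := h8.1; omega
      · have := h8.deg h; omega
  rcases hW with hW | hW | hW
  · have := h1.2 hW; omega
  · have hng : ¬ Gd G b := Ctx.not_gd_three (by have := hW.1; omega)
    have : gv G b y = 1 := by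
      unfold gv cg
      simp [hng, hdy, hW.p3, hW]
    omega
  · have : gv G b y = 1 := by
      unfold gv cg
      simp [hW.not_gd, hdy, h.not_p3_w45 hW, hW]
    omega

lemma Ctx.recv_two (h : Ctx Δ G K) {y : V} (hdy : G.degree y = 2) : 4 ≤ recv G y := by
  have hpos : 0 < G.degree y := by omega
  obtain ⟨a, ha⟩ := (SimpleGraph.degree_pos_iff_exists_adj _ _).1 hpos
  obtain ⟨b, hne, hb, hN⟩ := other_nbr hdy ha
  have hr : recv G y = gv G a y + gv G b y := by
    unfold recv; rw [hN, Finset.sum_pair hne.symm]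
  rw [hr]
  have hl : ∀ t, G.Adj y t → G.degree t ≠ 1 := by
    intro t ht h1
    have h2 : 1 ≤ nn G y 0 := by
      apply nn_pos ht
      unfold lab; simp [h1]
    have h3 := Dn_le (G := G) y
    have := (h.f0 (v := y) (by omega) (by omega)).2.2
    omega
  by_cases h1 : WK G b
  · exact h.two_pair hdy ha hb hne h1
  · by_cases h2 : WK G a
    · have := h.two_pair hdy hb ha hne.symm h2
      omega
    · have := h.gv_nwk ha.symm hdy (hl a ha) h2
      have := h.gv_nwk hb.symm hdy (hl b hb) h1
      omega

lemma Ctx.t2_Tn (h : Ctx Δ G K) {w : V} (hT : T2 G w) : Tn G w ≤ 2 := by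
  by_contra hlt
  have h1 := dK_add h.hK (w := w) ((G.neighborFinset w).filter (fun x => G.degree x = 2)) ?_ ?_
  · have h2 := hT.1
    obtain ⟨t, ht, -⟩ := hT.p3.2
    have h3 := h.cov w t ht
    unfold Tn at hlt
    omega
  · intro x hx
    rw [Finset.mem_filter, SimpleGraph.mem_neighborFinset] at hx
    exact hx.1
  · intro x hx
    rw [Finset.mem_filter, SimpleGraph.mem_neighborFinset] at hx
    exact h.t2 hT hx.1 hx.2

lemma Ctx.p3_Dn (h : Ctx Δ G K) {z : V} (hd : G.degree z = 3) : Dn G z = 3 := by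
  have h3 := Dn_le (G := G) z
  by_contra hne
  have := (h.f0 (v := z) (by omega) (by omega)).1
  omega

lemma Ctx.p3_give (h : Ctx Δ G K) {z : V} (hp : P3 G z) : give G z = 2 := by
  have hd := hp.1
  rw [give_non (Ctx.not_gd_three (by omega))]
  unfold cg
  by_cases hT : T2 G z
  · have h1 := h.t2_Tn hT
    have h2 := hT.2
    simp only [hp, hT, if_true]
    omega
  · simp only [hp, hT, if_true, if_false]
    have h1 : ¬ 2 ≤ Tn G z := fun hh => hT ⟨hd, hh⟩
    have h2 : 0 < Tn G z := by
      obtain ⟨x, hx, hdx⟩ := hp.2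
      apply Finset.card_pos.2
      exact ⟨x, Finset.mem_filter.2 ⟨by simpa using hx, hdx⟩⟩
    omega

lemma Ctx2.charge (h : Ctx2 Δ G K) {v : V} (hd : 2 ≤ G.degree v) :
    12 + give G v ≤ 4 * Dn G v + recv G v := by
  by_cases hg : Gd G v
  · rw [give_good hg, Dn_nn]
    have := (h.good_charge hg).1
    omega
  · by_cases hW : W45 G v
    · rw [give_non hg]
      have : cg G v = 1 := by unfold cg; simp [h.not_p3_w45 hW, hW]
      rw [this, Tn_nn, Dn_nn]
      have h1 := hW.1
      rw [Dn_nn] at h1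
      omega
    · have hD : Dn G v ≤ 3 := by
        by_contra hlt
        exact hg ⟨by omega, hW⟩
      by_cases hD2 : Dn G v ≤ 2
      · obtain ⟨h1, h2, h3⟩ := h.f0 hd hD2
        have h4 := h.recv_two h1
        have h5 : ¬ P3 G v := fun hp => by have := hp.1; omega
        rw [give_non hg]
        have : cg G v = 0 := by unfold cg; simp [h5, hW]
        rw [this]
        omega
      · by_cases hp : P3 G v
        · rw [h.p3_give hp]
          obtain ⟨g, h1, h2⟩ := h.p3_good hp
          have h3 := gv_le_recv h1
          rw [gv_good_p3 h2 hp] at h3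
          omega
        · rw [give_non hg]
          have : cg G v = 0 := by unfold cg; simp [hp, hW]
          rw [this]
          omega

lemma sum_give_recv : ∑ v, give G v = ∑ x, recv G x := by
  unfold give recv
  apply Finset.sum_comm'
  intro x y
  simp [SimpleGraph.adj_comm]

lemma Ctx2.zero (h : Ctx2 Δ G K) : ∀ v, 2 ≤ G.degree v → 12 + give G v = 4 * Dn G v + recv G v := by
  set C := Finset.univ.filter (fun v => 2 ≤ G.degree v) with hC
  have hle : ∀ v ∈ C, 12 + give G v ≤ 4 * Dn G v + recv G v := by
    intro v hv
    rw [hC, Finset.mem_filter] at hv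
    exact h.charge hv.2
  have h1 : ∑ v ∈ C, Dn G v ≤ 3 * C.card := by
    refine le_trans (le_of_eq (Finset.sum_congr rfl fun v _ => ?_)) (h.cls.sp C)
    unfold Dn
    congr 1
    ext x
    simp only [Finset.mem_filter, Finset.mem_inter, SimpleGraph.mem_neighborFinset, hC,
      Finset.mem_univ, true_and]
    refine and_congr_right fun hx => ?_
    have : 0 < G.degree x := (SimpleGraph.degree_pos_iff_exists_adj _ _).2 ⟨v, hx.symm⟩
    omega
  have h2 : ∑ v ∈ C, give G v = ∑ v, give G v := by
    apply Finset.sum_subset (Finset.subset_univ _)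
    intro v _ hv
    simp only [hC, Finset.mem_filter, Finset.mem_univ, true_and] at hv
    rw [give_non (Ctx.not_gd_three (by omega))]
    have h5 : ¬ P3 G v := fun hp => by have := hp.1; omega
    have h6 : ¬ W45 G v := fun hp => by have := W45.deg h.toCtx hp; omega
    have : cg G v = 0 := by unfold cg; simp [h5, h6]
    rw [this, mul_zero]
  have h3 : ∑ v ∈ C, recv G v ≤ ∑ v, recv G v :=
    Finset.sum_le_sum_of_subset (Finset.subset_univ _)
  rw [← sum_give_recv, ← h2] at h3
  have h4 : ∑ v ∈ C, (12 + give G v) = ∑ v ∈ C, (4 * Dn G v + recv G v) := by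
    apply le_antisymm (Finset.sum_le_sum hle)
    rw [Finset.sum_add_distrib, Finset.sum_add_distrib, ← Finset.mul_sum, Finset.sum_const,
      smul_eq_mul]
    omega
  have h5 := (Finset.sum_eq_sum_iff_of_le hle).1 h4
  intro v hv
  exact h5 v (by simp [hC, hv])

end part5

section part6
variable {V : Type} [Fintype V] {Δ : ℕ} {G : SimpleGraph V} {K : Finset (Sym2 V)}

lemma Gd.deg {v : V} (hg : Gd G v) : 4 ≤ G.degree v := hg.1.trans (Dn_le v)

lemma Ctx2.z_eq (h : Ctx2 Δ G K) {v : V} (hg : Gd G v) :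
    4 * nn G v 1 + 2 * nn G v 2 + 2 * nn G v 3 = 12 ∧ nn G v 5 = 0 := by
  have h1 := h.zero v (by have := hg.deg; omega)
  rw [give_good hg, Dn_nn] at h1
  have h2 := h.good_charge hg
  have h3 : nn G v 5 = 0 := h2.2 (by omega)
  omega

lemma nbr_unique {y a b w : V} (hN : G.neighborFinset y = {a, b}) (h1 : w ≠ a)
    (h2 : G.Adj y w) : w = b := by
  rw [← SimpleGraph.mem_neighborFinset, hN] at h2
  simp only [Finset.mem_insert, Finset.mem_singleton] at h2
  tauto

lemma Ctx2.z_noWK' (h : Ctx2 Δ G K) {w y : V} (hy : G.Adj w y) (hdy : G.degree y = 2)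
    (hW : T2 G w ∨ W45 G w) : False := by
  obtain ⟨v, hne, hv, hN⟩ := other_nbr hdy hy.symm
  have hg := (h.f4 hdy hv hy.symm hne.symm (Or.inr hW)).2.2.2.2
  have h5 := (h.z_eq hg).2
  rw [Finset.pair_comm] at hN
  rcases lab_cases G v y with h3 | h3 | h3 | h3 | h3 | h3
  · omega
  · exact absurd (Or.inl hdy) h3.2.2
  · have := h3.2.1; omega
  · exact h3.2.2.2 ⟨w, hne.symm, hy.symm, hW⟩
  · obtain ⟨w', h6, h7, h8⟩ := h3.2.2
    rw [nbr_unique hN h6 h7] at h8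
    rcases hW with hW | hW
    · have := hW.1; omega
    · have := W45.deg h.toCtx hW; omega
  · have := nn_pos hv.symm h3.1
    omega

lemma Ctx2.z_noT2 (h : Ctx2 Δ G K) (w : V) : ¬ T2 G w := by
  intro hT
  obtain ⟨-, y, hy, hdy⟩ := hT.p3
  exact h.z_noWK' hy hdy (Or.inl hT)

lemma Ctx2.z_noW (h : Ctx2 Δ G K) (w : V) : ¬ W45 G w := by
  intro hW
  have h1 := h.zero w (by have := W45.deg h.toCtx hW; omega)
  have hc : cg G w = 1 := by unfold cg; simp [h.not_p3_w45 hW, hW]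
  rw [give_non hW.not_gd, hc] at h1
  have h2 := hW.1
  have h3 : 0 < Tn G w := by omega
  obtain ⟨y, hy⟩ := Finset.card_pos.1 h3
  rw [Finset.mem_filter, SimpleGraph.mem_neighborFinset] at hy
  exact h.z_noWK' hy.1 hy.2 (Or.inr hW)

lemma Ctx2.z_p3 (h : Ctx2 Δ G K) {z : V} (hp : P3 G z) :
    ∃ x v a, G.neighborFinset z = {x, v, a} ∧ G.Adj z x ∧ G.Adj z v ∧ G.Adj z a ∧
      G.degree x = 2 ∧ Gd G v ∧ G.degree a = 3 ∧ s(z, x) ∉ K ∧ dK K z ≤ 2 ∧ dK K x ≤ 1 ∧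
      Sg G K z = dK K x + dK K v + dK K a := by
  have hp' := hp
  obtain ⟨hd, x, hx, hdx⟩ := hp
  obtain ⟨a, b, hab, hax, hbx, ha, hb, hN, hS⟩ := three_nbrs (K := K) hd hx
  have hz := h.zero z (by omega)
  rw [h.p3_give hp', h.p3_Dn hd] at hz
  have hr : recv G z = gv G x z + gv G a z + gv G b z := by
    unfold recv
    rw [hN, Finset.sum_insert (by simp [hax.symm, hbx.symm]), Finset.sum_pair hab, add_assoc]
  have hboth : ¬ (Gd G a ∧ Gd G b) := by
    rintro ⟨h1, h2⟩
    rw [gv_good_p3 h1 hp', gv_good_p3 h2 hp'] at hr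
    omega
  have non : ∀ t, G.Adj z t → t ≠ x → ¬ Gd G t → G.degree t = 3 := by
    intro t ht hne hg
    rcases h.nongood ht.symm (Or.inr hp') (h.p3_noleaf hd ht) hg with h1 | h1 | h1
    · exact absurd ⟨hd, two_le_Tn hne ht hx h1 hdx⟩ (h.z_noT2 z)
    · exact h1
    · exact absurd h1.1 (h.z_noW t)
  obtain ⟨v, a', hv, ha', hN', hS', hg, hd'⟩ : ∃ v a', G.Adj z v ∧ G.Adj z a' ∧
      G.neighborFinset z = {x, v, a'} ∧ Sg G K z = dK K x + dK K v + dK K a' ∧ Gd G v ∧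
      G.degree a' = 3 := by
    obtain ⟨g, hzg, hg⟩ := h.p3_good hp'
    rcases mem3 hN hzg with h1 | h1 | h1
    · rw [h1] at hg
      have := hg.deg; omega
    · rw [h1] at hg
      exact ⟨a, b, ha, hb, hN, hS, hg, non b hb hbx (fun hh => hboth ⟨hg, hh⟩)⟩
    · rw [h1] at hg
      exact ⟨b, a, hb, ha, by rw [hN, Finset.pair_comm], by omega, hg,
        non a ha hax (fun hh => hboth ⟨hh, hg⟩)⟩
  have hk : s(z, x) ∉ K := by
    intro hk
    have h3 := h.cs2 hk
    obtain ⟨u, hu, -, hM⟩ := other_nbr hdx hx.symm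
    have h4 := Sg_two (K := K) hM hu
    have h5 := h.dle a'
    have h6 := h.dΔ v
    have h7 := h.dΔ u
    have := h.hΔ
    omega
  have h8 := dK_lt h.hK hx hk
  have h9 := dK_lt' h.hK hx hk
  exact ⟨x, v, a', hN', hx, hv, ha', hdx, hg, hd', hk, by omega, by omega, hS'⟩

lemma Ctx2.z_f (h : Ctx2 Δ G K) (v : V) : ∀ x, G.Adj v x →
    dK K x ≤ (![1, Δ, 2, 2, 1, 1] : Fin 6 → ℕ) (lab G v x) := by
  intro x hx
  have h1 := h.dle x
  have h2 := h.dΔ x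
  rcases lab_cases G v x with h3 | h3 | h3 | h3 | h3 | h3
  · rw [h3.1]; simp; omega
  · rw [h3.1]; simp; omega
  · obtain ⟨_, _, _, _, _, _, _, _, _, _, _, h4, _⟩ := h.z_p3 h3.2
    rw [h3.1]; simpa
  · rw [h3.1]; simp; omega
  · have := (h.lab45 hx (Or.inl h3.1)).1; rw [h3.1]; simp; omega
  · have := (h.lab45 hx (Or.inr h3.1)).1; rw [h3.1]; simp; omega

lemma Ctx2.z_g (h : Ctx2 Δ G K) {g : V} (hg : Gd G g) (hp : 1 ≤ nn G g 2 + nn G g 3) :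
    nn G g 0 = 0 ∧ nn G g 4 = 0 ∧ nn G g 5 = 0 := by
  have h0 := h.z_eq hg
  have h3 := Sg_le_lab (K := K) g _ (h.z_f g)
  simp only [Matrix.cons_val] at h3
  have h4 := h.leaf' g
  have h5 := h.dsum g
  have h6 := h.hΔ
  have h7 : nn G g 4 ≤ 1 ∨ 3 * Δ + 1 ≤ Sg G K g := by
    by_cases h8 : nn G g 4 ≤ 1
    · exact Or.inl h8
    · exact Or.inr (h.s1_le (by omega))
  have h8 : nn G g 4 + nn G g 5 = 0 ∨ 3 * Δ ≤ Sg G K g := by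
    by_cases h9 : nn G g 4 + nn G g 5 = 0
    · exact Or.inl h9
    · exact Or.inr (h.s_pos (by omega))
  have hk : nn G g 1 ≤ 2 := by omega
  generalize nn G g 1 = k at *
  interval_cases k <;> omega

lemma Ctx.two_noleaf (h : Ctx Δ G K) {y t : V} (hdy : G.degree y = 2) (ht : G.Adj y t) :
    G.degree t ≠ 1 := by
  intro h1
  have h2 : 1 ≤ nn G y 0 := by
    apply nn_pos ht
    unfold lab; simp [h1]
  have h3 := Dn_le (G := G) y
  have := (h.f0 (v := y) (by omega) (by omega)).2.2
  omega

/-- the other neighbour of a 2-vertex with label 3 -/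
lemma Ctx2.z_other (h : Ctx2 Δ G K) {g z w : V} (hg : Gd G g) (hz : G.Adj z g) (hzw : G.Adj z w)
    (hne : w ≠ g) (hdz : G.degree z = 2) (h4 : nn G g 4 = 0) :
    P3 G w ∨ (Gd G w ∧ lab G w z = 3) := by
  have hN := two_nbrs hdz hz hzw hne.symm
  rw [Finset.pair_comm] at hN
  rcases h.wk_cases hzw.symm hdz (h.two_noleaf hdz hzw) with h1 | h1 | h1
  · right
    refine ⟨h1, ?_⟩
    rcases lab_cases G w z with h3 | h3 | h3 | h3 | h3 | h3
    · omega
    · exact absurd (Or.inl hdz) h3.2.2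
    · have := h3.2.1; omega
    · exact h3.1
    · obtain ⟨w', h6, h7, h8⟩ := h3.2.2
      rw [nbr_unique hN h6 h7] at h8
      have := hg.deg; omega
    · have := nn_pos hzw.symm h3.1
      have := (h.z_eq h1).2
      omega
  · exfalso
    rcases h1 with h1 | h1 | h1
    · rcases lab_cases G g z with h3 | h3 | h3 | h3 | h3 | h3
      · omega
      · exact h3.2.2 (Or.inl hdz)
      · have := h3.2.1; omega
      · exact h3.2.2.1 ⟨w, hne, hzw, h1⟩
      · have := nn_pos hz.symm h3.1; omega
      · have := nn_pos hz.symm h3.1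
        have := (h.z_eq hg).2
        omega
    · exact h.z_noT2 w h1
    · exact h.z_noW w h1
  · exact Or.inl h1.1

lemma Ctx2.z_edgeM (h : Ctx2 Δ G K) {M : ℕ} (hM4 : 4 ≤ M)
    (hM : ∀ g, Gd G g → 1 ≤ nn G g 2 + nn G g 3 → dK K g ≤ M)
    {g z : V} (hg : Gd G g) (hp : 1 ≤ nn G g 2 + nn G g 3) (hz : G.Adj g z) (hpz : Poor G z)
    (hlt : nn G g 1 * Δ + 2 * (nn G g 2 + nn G g 3) + M < 3 * Δ + 2) : s(g, z) ∉ K := by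
  intro hk
  obtain ⟨n0, n4, n5⟩ := h.z_g hg hp
  have h1 := Sg_le_lab' (K := K) g z hz _ (h.z_f g)
  have hl : (![1, Δ, 2, 2, 1, 1] : Fin 6 → ℕ) (lab G g z) = 2 := by
    rcases lab_cases G g z with h3 | h3 | h3 | h3 | h3 | h3
    · have := nn_pos hz h3.1; omega
    · exact absurd hpz h3.2.2
    · rw [h3.1]; simp
    · rw [h3.1]; simp
    · have := nn_pos hz h3.1; omega
    · have := nn_pos hz h3.1; omega
  rw [hl] at h1
  simp only [Matrix.cons_val] at h1
  have h2 := h.cs2 hk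
  have hs : Sg G K z ≤ dK K g + M := by
    rcases hpz with hdz | hp3
    · obtain ⟨w, hne, hzw, hN⟩ := other_nbr hdz hz.symm
      rw [Sg_two hN hne]
      have : dK K w ≤ M := by
        rcases h.z_other hg hz.symm hzw hne hdz n4 with h5 | h5
        · obtain ⟨_, _, _, _, _, _, _, _, _, _, _, h4, _⟩ := h.z_p3 h5
          omega
        · exact hM w h5.1 (by have := nn_pos hzw.symm h5.2; omega)
      omega
    · obtain ⟨x, v, a, hN, hx, hv, ha, hdx, hgv, hda, -, -, hx1, hS⟩ := h.z_p3 hp3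
      have h5 := h.dle a
      rcases mem3 hN hz.symm with h6 | h6 | h6
      · rw [h6] at hg; have := hg.deg; omega
      · rw [h6]; omega
      · rw [h6] at hg; have := hg.deg; omega
  omega

lemma Ctx2.z_k1 (h : Ctx2 Δ G K) {g z : V} (hg : Gd G g) (hp : 1 ≤ nn G g 2 + nn G g 3)
    (hk : nn G g 1 ≤ 1) (hz : G.Adj g z) (hpz : Poor G z) : s(g, z) ∉ K := by
  have h0 := h.z_eq hg
  have h6 := h.hΔ
  refine h.z_edgeM (M := 6) (by omega) ?_ hg hp hz hpz ?_
  · intro g' hg' hp'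
    have h1 := h.dle g'
    have h2 := h.z_g hg' hp'
    have h3 := h.z_eq hg'
    rw [deg_nn] at h1
    omega
  · generalize nn G g 1 = k at *
    interval_cases k <;> omega

lemma Ctx2.z_4 (h : Ctx2 Δ G K) {g : V} (hg : Gd G g) (hp : 1 ≤ nn G g 2 + nn G g 3) :
    dK K g ≤ 4 := by
  have h1 := h.dle g
  have h2 := h.z_g hg hp
  have h3 := h.z_eq hg
  by_cases hk : nn G g 1 ≤ 1
  · have h4 := dK_add h.hK (w := g) ((G.neighborFinset g).filter (fun x => Poor G x)) ?_ ?_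
    · have h5 : ((G.neighborFinset g).filter (fun x => Poor G x)).card =
          nn G g 2 + nn G g 3 + nn G g 4 + nn G g 5 := by
        rw [card_lab g _ ![0, 0, 1, 1, 1, 1]]
        · simp
        · intro x _
          rcases lab_cases G g x with h | h | h | h | h | h
          · have : ¬ Poor G x := by
              rintro (h3 | h3)
              · omega
              · have := h3.1; omega
            simp [h.1, this]
          · simp [h.1, h.2.2]
          · simp [h.1, Poor, h.2]
          · simp [h.1, Poor, h.2.1]
          · simp [h.1, Poor, h.2.1]
          · simp [h.1, Poor, h.2.1]
      rw [deg_nn] at h4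
      omega
    · intro x hx
      rw [Finset.mem_filter, SimpleGraph.mem_neighborFinset] at hx
      exact hx.1
    · intro x hx
      rw [Finset.mem_filter, SimpleGraph.mem_neighborFinset] at hx
      exact h.z_k1 hg hp hk hx.1 hx.2
  · rw [deg_nn] at h1
    omega

lemma Ctx2.z_edge (h : Ctx2 Δ G K) {g z : V} (hg : Gd G g) (hp : 1 ≤ nn G g 2 + nn G g 3)
    (hz : G.Adj g z) (hpz : Poor G z) : s(g, z) ∉ K := by
  have h0 := h.z_eq hg
  have h6 := h.hΔ
  refine h.z_edgeM (M := 4) (by omega) (fun g' => h.z_4) hg hp hz hpz ?_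
  have hk : nn G g 1 ≤ 2 := by omega
  generalize nn G g 1 = k at *
  interval_cases k <;> omega

lemma lab_p3 {v z : V} (hp : P3 G z) : lab G v z = 2 := by
  have := hp.1
  unfold lab
  have h1 : G.degree z ≠ 1 := by omega
  have h2 : G.degree z ≠ 2 := by omega
  simp [h1, h2, hp]

lemma Ctx2.z_noP3 (h : Ctx2 Δ G K) (z : V) : ¬ P3 G z := by
  intro hp
  obtain ⟨x, v, a, hN, hx, hv, ha, hdx, hgv, hda, hkx, -, hx1, hS⟩ := h.z_p3 hp
  have hn : 1 ≤ nn G v 2 + nn G v 3 := by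
    have := nn_pos hv.symm (lab_p3 (v := v) hp); omega
  have hkv := h.z_edge hgv hn hv.symm (Or.inr hp)
  apply h.cov' hx
  intro t ht
  rcases mem3 hN ht with h1 | h1 | h1
  · rw [h1]; exact hkx
  · rw [h1, Sym2.eq_swap]; exact hkv
  · rw [h1]
    intro hk
    have h2 := h.cs2 hk
    obtain ⟨p, q, -, -, -, -, -, -, hS'⟩ := three_nbrs (K := K) hda ha.symm
    have h3 := h.dΔ p
    have h4 := h.dΔ q
    have h5 := h.z_4 hgv hn
    have := h.hΔ
    omega

lemma Ctx2.z_p0 (h : Ctx2 Δ G K) {g : V} (hg : Gd G g) : nn G g 2 = 0 ∧ nn G g 3 = 0 := by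
  have h2 : nn G g 2 = 0 := by
    by_contra hne
    obtain ⟨x, hx⟩ := Finset.card_pos.1 (Nat.pos_of_ne_zero hne)
    rw [Finset.mem_filter] at hx
    rcases lab_cases G g x with h1 | h1 | h1 | h1 | h1 | h1
    · rw [hx.2] at h1; exact absurd h1.1 (by decide)
    · rw [hx.2] at h1; exact absurd h1.1 (by decide)
    · exact h.z_noP3 x h1.2
    all_goals rw [hx.2] at h1; exact absurd h1.1 (by decide)
  refine ⟨h2, ?_⟩
  by_contra hne
  obtain ⟨z, hz⟩ := Finset.card_pos.1 (Nat.pos_of_ne_zero hne)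
  rw [Finset.mem_filter, SimpleGraph.mem_neighborFinset] at hz
  have hp : 1 ≤ nn G g 2 + nn G g 3 := by omega
  have n4 := (h.z_g hg hp).2.1
  have hdz : G.degree z = 2 := by
    rcases lab_cases G g z with h1 | h1 | h1 | h1 | h1 | h1
    · rw [hz.2] at h1; exact absurd h1.1 (by decide)
    · rw [hz.2] at h1; exact absurd h1.1 (by decide)
    · rw [hz.2] at h1; exact absurd h1.1 (by decide)
    all_goals exact h1.2.1
  obtain ⟨w, hwne, hzw, hN⟩ := other_nbr hdz hz.1.symm
  rcases h.z_other hg hz.1.symm hzw hwne hdz n4 with h5 | h5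
  · exact h.z_noP3 w h5
  · have hpw : 1 ≤ nn G w 2 + nn G w 3 := by
      have := nn_pos hzw.symm h5.2; omega
    have e1 := h.z_edge hg hp hz.1 (Or.inl hdz)
    have e2 := h.z_edge h5.1 hpw hzw.symm (Or.inl hdz)
    apply h.cov' hzw
    intro t ht
    by_cases htg : t = g
    · rw [htg, Sym2.eq_swap]; exact e1
    · rw [nbr_unique hN htg ht, Sym2.eq_swap]; exact e2

lemma Ctx2.z_three (h : Ctx2 Δ G K) {v : V} (hd : 3 ≤ G.degree v) : nn G v 1 = 3 := by
  by_cases hg : Gd G v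
  · have := h.z_p0 hg
    have := h.z_eq hg
    omega
  · have hD : Dn G v ≤ 3 := by
      by_contra hlt
      exact hg ⟨by omega, h.z_noW v⟩
    have hD3 : Dn G v = 3 := by
      by_contra hne
      have := (h.f0 (v := v) (by omega) (by omega)).1
      omega
    have h0 : ∀ x, G.Adj v x → ¬ Poor G x := by
      intro x hx hp
      have hd3 := (h.f0' hD3 (poor_pos hx hp)).1
      rcases hp with hp | hp
      · exact h.z_noP3 v ⟨hd3, x, hx, hp⟩
      · exact h.z_noP3 x hp
    rw [← Kn_nn, ← hD3]
    unfold Kn Dn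
    congr 1
    apply Finset.filter_congr
    intro x hx
    rw [SimpleGraph.mem_neighborFinset] at hx
    simp [h0 x hx]

/-- the subgraph induced by vertices of degree at least three -/
def bigG (G : SimpleGraph V) : SimpleGraph V where
  Adj a b := G.Adj a b ∧ 3 ≤ G.degree a ∧ 3 ≤ G.degree b
  symm := ⟨fun _ _ h => ⟨h.1.symm, h.2.2, h.2.1⟩⟩
  loopless := ⟨fun a h => G.loopless.irrefl a h.1⟩

lemma Ctx2.false (h : Ctx2 Δ G K) : False := by
  have hN : ∀ v, 3 ≤ G.degree v → ((bigG G).neighborSet v).ncard = 3 := by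
    intro v hv
    rw [← h.z_three hv, ← Kn_nn]
    unfold Kn
    rw [← Set.ncard_coe_finset]
    congr 1
    ext x
    simp only [SimpleGraph.mem_neighborSet, Finset.coe_filter, SimpleGraph.mem_neighborFinset,
      Set.mem_setOf_eq]
    have hp3 := h.z_noP3 x
    constructor
    · rintro ⟨h1, -, h3⟩
      refine ⟨h1, by omega, ?_⟩
      rintro (h4 | h4)
      · omega
      · exact hp3 h4
    · rintro ⟨h1, h2, h3⟩
      have h5 : G.degree x ≠ 2 := fun hh => h3 (Or.inl hh)
      have h6 : 0 < G.degree x := (SimpleGraph.degree_pos_iff_exists_adj _ _).2 ⟨v, h1.symm⟩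
      exact ⟨h1, hv, by omega⟩
  obtain ⟨v, hv⟩ : ∃ v, 3 ≤ G.degree v := by
    by_contra hno
    push Not at hno
    obtain ⟨e, he⟩ := h.ne
    induction e using Sym2.ind with
    | _ a b =>
      have h1 := h.cs2 he
      have h2 : ∀ v, Sg G K v ≤ 4 := by
        intro v
        have h3 : Sg G K v ≤ ∑ x ∈ G.neighborFinset v, 2 := by
          apply Finset.sum_le_sum
          intro x _
          have := h.dle x
          have := hno x
          omega
        rw [Finset.sum_const, smul_eq_mul, SimpleGraph.card_neighborFinset_eq_degree] at h3
        have := hno v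
        omega
      have h4 := h2 a
      have h5 := h2 b
      have := h.hΔ
      omega
  apply h.cls.rg
  refine ⟨bigG G, fun a b hab => hab.1, ?_, ?_⟩
  · have h1 := hN v hv
    have h2 : ((bigG G).neighborSet v).Nonempty := by
      apply Set.nonempty_of_ncard_ne_zero; omega
    obtain ⟨x, hx⟩ := h2
    exact ⟨v, x, hx⟩
  · rintro a ⟨b, hab⟩
    exact hN a hab.2.1

end part6

section part7
variable {V : Type} [Fintype V]

lemma MinC.false {Δ : ℕ} (hΔ : 7 ≤ Δ) {G : SimpleGraph V} (hG : MinC Δ G) : False := by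
  obtain ⟨K, hK, hn, hc⟩ := exists_K G (3 * Δ) hG.nc
  have hctx : Ctx Δ G K := by
    refine ⟨hΔ, hG.cls, hK, fun u v huv => count_union hK hc huv, ?_⟩
    intro x y hxy
    obtain ⟨e, he, hxe⟩ := covered hG hK hn hxy
    exact Finset.card_pos.2 ⟨e, Finset.mem_filter.2 ⟨he, hxe⟩⟩
  have hctx2 : Ctx2 Δ G K := by
    refine ⟨hctx, ?_, ?_⟩
    · intro v y1 w1 y2 w2 a1 a2 a3 a4 a5 a6 a7 a8 a9 a10 a11
      exact h6 hG hctx hn a1 a2 a3 a4 a5 a6 a7 a8 a9 a10 a11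
    · rw [Finset.nonempty_iff_ne_empty]
      rintro rfl
      exact hn ⟨fun _ => ⟨0, by omega⟩, fun e he => by simp at he⟩
  exact hctx2.false

lemma main_col {Δ : ℕ} (hΔ : 7 ≤ Δ) : ∀ (n : ℕ) (G : SimpleGraph V), G.edgeSet.ncard = n →
    Cls Δ G → HasStrongColoring G (3 * Δ) := by
  intro n
  induction n using Nat.strong_induction_on with
  | _ n ih =>
    intro G hn hc
    by_contra hno
    apply MinC.false hΔ (G := G)
    exact ⟨hc, hno, fun H hH hlt => ih _ (hn ▸ hlt) H rfl hH⟩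

lemma sum_inter (G : SimpleGraph V) (A : Finset V) :
    ∑ v ∈ A, (G.neighborFinset v ∩ A).card = 2 * {e ∈ G.edgeSet | ∀ v ∈ e, v ∈ A}.ncard := by
  let F : SimpleGraph V :=
    { Adj := fun a b => G.Adj a b ∧ a ∈ A ∧ b ∈ A
      symm := ⟨fun _ _ h => ⟨h.1.symm, h.2.2, h.2.1⟩⟩
      loopless := ⟨fun a h => G.loopless.irrefl a h.1⟩ }
  have h1 : {e ∈ G.edgeSet | ∀ v ∈ e, v ∈ A} = F.edgeSet := by
    ext e
    induction e using Sym2.ind with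
    | _ a b => simp [F]
  have h2 : F.edgeSet.ncard = F.edgeFinset.card := by
    rw [← SimpleGraph.coe_edgeFinset, Set.ncard_coe_finset]
  rw [h1, h2, ← SimpleGraph.sum_degrees_eq_twice_card_edges]
  have h3 : ∀ v ∈ A, (G.neighborFinset v ∩ A).card = F.degree v := by
    intro v hv
    rw [← SimpleGraph.card_neighborFinset_eq_degree]
    congr 1
    ext x
    simp [F, hv]
  rw [Finset.sum_congr rfl h3]
  apply Finset.sum_subset (Finset.subset_univ _)
  intro v _ hv
  rw [← SimpleGraph.card_neighborFinset_eq_degree, Finset.card_eq_zero,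
    Finset.eq_empty_iff_forall_notMem]
  intro x hx
  rw [SimpleGraph.mem_neighborFinset] at hx
  exact hv hx.2.1

lemma cls_of_goodB {Δ : ℕ} {G : SimpleGraph V} (h : GoodB Δ G) : Cls Δ G := by
  obtain ⟨h1, h2, h3⟩ := h
  refine ⟨?_, fun v => (G.degree_le_maxDegree v).trans h2, h3⟩
  intro A
  rcases A.eq_empty_or_nonempty with rfl | hA
  · simp
  rw [sum_inter]
  have hfin : {x : ℝ | ∃ A : Finset V, A.Nonempty ∧
      x = 2 * ({e ∈ G.edgeSet | ∀ v ∈ e, v ∈ A}.ncard : ℝ) / (A.card : ℝ)}.Finite := by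
    apply Set.Finite.subset (Set.finite_range (fun A : Finset V =>
      2 * ({e ∈ G.edgeSet | ∀ v ∈ e, v ∈ A}.ncard : ℝ) / (A.card : ℝ)))
    rintro x ⟨A, -, rfl⟩
    exact ⟨A, rfl⟩
  have h4 : 2 * ({e ∈ G.edgeSet | ∀ v ∈ e, v ∈ A}.ncard : ℝ) / (A.card : ℝ) ≤ 3 :=
    le_trans (le_csSup hfin.bddAbove ⟨A, hA, rfl⟩) h1
  have hpos : (0 : ℝ) < A.card := by exact_mod_cast Finset.card_pos.2 hA
  rw [div_le_iff₀ hpos] at h4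
  exact_mod_cast h4

end part7

/-- In a minimal counterexample `G` to `χ'_s ≤ 3Δ` (`Mad ≤ 3`, maximum degree at most
`Δ ≥ 7`, no 3-regular subgraph), for every vertex `v` of `G*`: (i) if `d_{G*}(v) < Δ`
then some `G*`-neighbor of `v` is neither poor nor very poor, i.e. is neither of degree 2
in `G*` nor a poor 3-vertex; (ii) if `d_{G*}(v) = Δ` then either some `G*`-neighbor of
`v` is neither poor nor very poor, or `v` is not a sponsor of any very poor vertex. -/
theorem minCexB_neighbor_not_poor (Δ : ℕ) (hΔ : 7 ≤ Δ) {V : Type} [Fintype V]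
    (G : SimpleGraph V) (hG : MinCexB Δ G) :
    ∀ v : V, G.degree v ≠ 1 →
      (((core G).degree v < Δ →
        ∃ u, (core G).Adj v u ∧ ¬ ((core G).degree u = 2 ∨ Poor3 G u)) ∧
      ((core G).degree v = Δ →
        (∃ u, (core G).Adj v u ∧ ¬ ((core G).degree u = 2 ∨ Poor3 G u)) ∨
          ¬ ∃ u w, VeryPoorWith G u v w)) := by
  exact absurd (main_col hΔ _ G rfl (cls_of_goodB hG.1)) hG.2.1

end StrongEC
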